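/- Let G be a bridgeless cubic graph and let 𝒪 be any collection of pairwise vertex-disjoint odd circuits in G. Then there exists a perfect matching M of G such that M contains at least one edge of every circuit in 𝒪. -/

import Mathlib

/-!
# Perfect matchings hitting disjoint odd circuits

The result is proved for cubic multigraphs, by induction on the number of vertices: a perfect
matching can be required to contain a given edge as well. Nontrivial cuts of size three are
contracted. Otherwise one deletes the ends of an edge next to the given edge, or two such pairs,
and joins the dangling edges, so that every circuit affected by the deletion is met by each
extension of a perfect matching of the smaller multigraph.
-/

/-- A cubic multigraph on a set of vertices of `V`, given by an involution `flip` of its darts: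
the three darts at `v` are the pairs `(v, i)`. -/
structure CubicMultigraph (V : Type*) where
  verts : Finset V
  flip : V × Fin 3 → V × Fin 3
  flip_flip : ∀ d, d.1 ∈ verts → flip (flip d) = d
  flip_mem : ∀ d, d.1 ∈ verts → (flip d).1 ∈ verts
  flip_ne : ∀ d, d.1 ∈ verts → flip d ≠ d

namespace CubicMultigraph

open Finset

section

variable {V L : Type*}

theorem flip_inj (G : CubicMultigraph V) {d d' : V × Fin 3} (hd : d.1 ∈ G.verts)
    (hd' : d'.1 ∈ G.verts) (h : G.flip d = G.flip d') : d = d' := by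
  rw [← G.flip_flip d hd, h, G.flip_flip d' hd']

variable [DecidableEq V]

theorem even_card_of_flip {D : Type*} (S : Finset D) (f : D → D) (hmem : ∀ d ∈ S, f d ∈ S)
    (hinv : ∀ d ∈ S, f (f d) = d) (hne : ∀ d ∈ S, f d ≠ d) : Even S.card := by
  have h : ∑ d ∈ S, (1 : ZMod 2) = 0 :=
    Finset.sum_involution (fun d _ => f d) (fun _ _ => by decide) (fun d hd _ => hne d hd)
      (fun d hd => hmem d hd) (fun d hd => hinv d hd)
  rw [Finset.sum_const, nsmul_eq_mul, mul_one] at h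
  exact (ZMod.natCast_eq_zero_iff_even).1 h

/-- The darts leaving `X`. -/
def cut (G : CubicMultigraph V) (X : Finset V) : Finset (V × Fin 3) :=
  (X ×ˢ univ).filter fun d => (G.flip d).1 ∉ X

/-- No vertex set is left by exactly one edge. -/
def Bridgeless (G : CubicMultigraph V) : Prop :=
  ∀ X ⊆ G.verts, (G.cut X).card ≠ 1

/-- Every edge cut of size three isolates at most one vertex. -/
def ThreeCutsTrivial (G : CubicMultigraph V) : Prop :=
  ∀ X ⊆ G.verts, (G.cut X).card = 3 → X.card ≤ 1 ∨ (G.verts \ X).card ≤ 1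

theorem mem_cut {G : CubicMultigraph V} {X : Finset V} {d : V × Fin 3} :
    d ∈ G.cut X ↔ d.1 ∈ X ∧ (G.flip d).1 ∉ X := by
  simp [cut]

theorem card_cut_compl (G : CubicMultigraph V) {X : Finset V} (hX : X ⊆ G.verts) :
    (G.cut (G.verts \ X)).card = (G.cut X).card := by
  refine Finset.card_nbij' G.flip G.flip ?_ ?_ ?_ ?_
  · intro d hd
    simp only [mem_coe, mem_cut, mem_sdiff, not_and, not_not] at hd ⊢
    have h1 := G.flip_mem d hd.1.1
    rw [G.flip_flip d hd.1.1]
    exact ⟨hd.2 h1, hd.1.2⟩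
  · intro d hd
    simp only [mem_coe, mem_cut, mem_sdiff, not_and, not_not] at hd ⊢
    have h0 := hX hd.1
    rw [G.flip_flip d h0]
    exact ⟨⟨G.flip_mem d h0, hd.2⟩, fun _ => hd.1⟩
  · intro d hd
    simp only [mem_coe, mem_cut, mem_sdiff] at hd
    exact G.flip_flip d hd.1.1
  · intro d hd
    simp only [mem_coe, mem_cut] at hd
    exact G.flip_flip d (hX hd.1)

theorem even_card_internal (G : CubicMultigraph V) {X : Finset V} (hX : X ⊆ G.verts)
    (P : V × Fin 3 → Prop) [DecidablePred P] (hP : ∀ d, d.1 ∈ X → P d → P (G.flip d)) :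
    Even ((X ×ˢ univ).filter fun d => P d ∧ (G.flip d).1 ∈ X).card := by
  refine even_card_of_flip _ G.flip ?_ ?_ ?_ <;> intro d hd <;>
    simp only [mem_filter, mem_product, mem_univ, and_true] at hd ⊢
  · rw [G.flip_flip d (hX hd.1)]
    exact ⟨hd.2.2, hP d hd.1 hd.2.1, hd.1⟩
  · exact G.flip_flip d (hX hd.1)
  · exact G.flip_ne d (hX hd.1)

theorem even_card_cut_iff (G : CubicMultigraph V) {X : Finset V} (hX : X ⊆ G.verts) :
    Even (G.cut X).card ↔ Even X.card := by
  have h1 := G.even_card_internal hX (fun _ => True) (fun _ _ h => h)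
  have h2 := Finset.card_filter_add_card_filter_not (s := X ×ˢ (univ : Finset (Fin 3)))
    (fun d => (G.flip d).1 ∈ X)
  simp only [true_and, card_product, card_univ, Fintype.card_fin] at h1 h2
  change _ + (G.cut X).card = _ at h2
  grind

/-- `lab` assigns labels to some vertices and `ext` distinguishes a dart at each vertex, such that
the other two darts at the labelled vertices form a 2-regular subgraph whose components are
monochromatic. -/
def IsLabelling (G : CubicMultigraph V) (lab : V → Option L) (ext : V → Fin 3) : Prop :=
  ∀ d, d.1 ∈ G.verts → ∀ c, lab d.1 = some c → d.2 ≠ ext d.1 →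
    lab (G.flip d).1 = some c ∧ (G.flip d).2 ≠ ext (G.flip d).1

/-- `m` selects the darts of a perfect matching. -/
def IsMatching (G : CubicMultigraph V) (m : V → Fin 3) : Prop :=
  ∀ d, d.1 ∈ G.verts → m d.1 = d.2 → m (G.flip d).1 = (G.flip d).2

theorem even_card_crossing [DecidableEq L] (G : CubicMultigraph V) {lab : V → Option L}
    {ext : V → Fin 3}
    (hlab : G.IsLabelling lab ext) {X : Finset V} (hX : X ⊆ G.verts) (c : L) :
    Even ((G.cut X).filter fun d => lab d.1 = some c ∧ d.2 ≠ ext d.1).card := by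
  have h1 := G.even_card_internal hX (fun d => lab d.1 = some c ∧ d.2 ≠ ext d.1)
    (fun d hd h => hlab d (hX hd) c h.1 h.2)
  have h2 : Even ((X ×ˢ (univ : Finset (Fin 3))).filter
      fun d => lab d.1 = some c ∧ d.2 ≠ ext d.1).card := by
    rw [Finset.card_filter, Finset.sum_product]
    refine Finset.even_sum _ fun v _ => ?_
    rw [← Finset.card_filter]
    by_cases h : lab v = some c
    · simp only [h, true_and]
      generalize ext v = i
      revert i; decide
    · simp [h]
  have h3 := Finset.card_filter_add_card_filter_not (s := (X ×ˢ (univ : Finset (Fin 3))).filter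
      fun d => lab d.1 = some c ∧ d.2 ≠ ext d.1) (fun d => (G.flip d).1 ∈ X)
  rw [Finset.filter_filter, Finset.filter_filter] at h3
  have h4 : (G.cut X).filter (fun d => lab d.1 = some c ∧ d.2 ≠ ext d.1) =
      (X ×ˢ (univ : Finset (Fin 3))).filter
        fun d => (lab d.1 = some c ∧ d.2 ≠ ext d.1) ∧ (G.flip d).1 ∉ X := by
    ext d; simp only [cut, mem_filter]; tauto
  rw [h4]
  grind

/-- There is a perfect matching through `e` meeting every odd class of the labelling. -/
def Solvable [DecidableEq L] (G : CubicMultigraph V) (lab : V → Option L) (ext : V → Fin 3)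
    (e : V × Fin 3) : Prop :=
  ∃ m : V → Fin 3, G.IsMatching m ∧ m e.1 = e.2 ∧
    ∀ c, Odd (G.verts.filter fun v => lab v = some c).card →
      ∃ v ∈ G.verts, lab v = some c ∧ m v ≠ ext v

end

/-! ### Small multigraphs -/

section

variable {V L : Type*} [DecidableEq V]

theorem Bridgeless.no_loop {G : CubicMultigraph V} (hG : G.Bridgeless) {d : V × Fin 3}
    (hd : d.1 ∈ G.verts) : (G.flip d).1 ≠ d.1 := by
  intro h
  have hX : ({d.1} : Finset V) ⊆ G.verts := by simpa using hd
  have h1 : ¬ Even (G.cut {d.1}).card := by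
    rw [G.even_card_cut_iff hX]; simp
  have h2 : G.cut {d.1} ⊆ (({d.1} : Finset V) ×ˢ univ) \ {d, G.flip d} := by
    intro d' hd'
    rw [mem_cut] at hd'
    simp only [mem_singleton] at hd'
    simp only [mem_sdiff, mem_product, mem_singleton, mem_univ, and_true, mem_insert, not_or]
    refine ⟨hd'.1, ?_, ?_⟩
    · rintro rfl; exact hd'.2 h
    · rintro rfl; rw [G.flip_flip d hd] at hd'; exact hd'.2 rfl
  have h3 : ({d, G.flip d} : Finset (V × Fin 3)) ⊆ ({d.1} : Finset V) ×ˢ univ := by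
    intro d' hd'
    simp only [mem_insert, mem_singleton] at hd'
    rcases hd' with rfl | rfl <;> simp only [mem_product, mem_singleton, mem_univ, and_true, h]
  have h4 := card_le_card h2
  rw [card_sdiff_of_subset h3, card_pair (G.flip_ne d hd).symm] at h4
  simp at h4
  have := hG _ hX
  have h5 : (G.cut {d.1}).card ≠ 0 := by
    intro h; rw [h] at h1; exact h1 (by decide)
  omega

theorem Bridgeless.card_cut_singleton {G : CubicMultigraph V} (hG : G.Bridgeless) {v : V}
    (hv : v ∈ G.verts) : (G.cut {v}).card = 3 := by
  have : G.cut {v} = ({v} : Finset V) ×ˢ univ := by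
    ext d
    simp only [mem_cut, mem_singleton, mem_product, mem_univ, and_true, and_iff_left_iff_imp]
    rintro rfl
    exact hG.no_loop hv
  simp [this]

theorem even_card_verts (G : CubicMultigraph V) : Even G.verts.card := by
  rw [← G.even_card_cut_iff Subset.rfl]
  have : G.cut G.verts = ∅ := by
    ext d
    simp only [mem_cut, notMem_empty, iff_false, not_and, not_not]
    exact G.flip_mem d
  simp [this]

theorem IsLabelling.three_le_card [DecidableEq L] {G : CubicMultigraph V} {lab : V → Option L}
    {ext : V → Fin 3}
    (hlab : G.IsLabelling lab ext) (hG : G.Bridgeless) {c : L}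
    (hc : Odd (G.verts.filter fun v => lab v = some c).card) :
    3 ≤ (G.verts.filter fun v => lab v = some c).card := by
  by_contra h
  have h1 : (G.verts.filter fun v => lab v = some c).card = 1 := by
    obtain ⟨k, hk⟩ := hc; omega
  obtain ⟨v, hv⟩ := card_eq_one.1 h1
  have hv' : v ∈ G.verts ∧ lab v = some c := by
    have := mem_singleton_self v
    rw [← hv] at this; simpa using this
  obtain ⟨i, hi⟩ : ∃ i, i ≠ ext v := exists_ne _
  have h2 := hlab (v, i) hv'.1 c hv'.2 hi
  have h3 : (G.flip (v, i)).1 ∈ G.verts.filter fun v => lab v = some c := by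
    simpa using ⟨G.flip_mem (v, i) hv'.1, h2.1⟩
  rw [hv, mem_singleton] at h3
  exact hG.no_loop hv'.1 h3

theorem Bridgeless.hits_of_card_eq_four [DecidableEq L] {G : CubicMultigraph V}
    (hG : G.Bridgeless) (hcard : G.verts.card = 4) {lab : V → Option L} {ext : V → Fin 3}
    (hlab : G.IsLabelling lab ext) {m : V → Fin 3} (hm : G.IsMatching m) {c : L}
    (hc : Odd (G.verts.filter fun v => lab v = some c).card) :
    ∃ v ∈ G.verts, lab v = some c ∧ m v ≠ ext v := by
  set S := G.verts.filter fun v => lab v = some c with hS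
  have hSW : S ⊆ G.verts := filter_subset _ _
  have hS3 : S.card = 3 := by
    have h1 := hlab.three_le_card hG hc
    rw [← hS] at h1
    have h2 := card_le_card hSW
    obtain ⟨k, hk⟩ := hc; omega
  obtain ⟨o, ho⟩ : ∃ o, G.verts \ S = {o} := by
    rw [← card_eq_one, card_sdiff_of_subset hSW]; omega
  have hoW : o ∈ G.verts := by
    have := mem_singleton_self o
    rw [← ho] at this; exact (mem_sdiff.1 this).1
  have hcut : (G.cut S).card = 3 := by
    rw [← G.card_cut_compl hSW, ho, hG.card_cut_singleton hoW]
  have hcutS : G.cut S = S.image fun v => (v, ext v) := by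
    refine eq_of_subset_of_card_le ?_ (card_image_le.trans (hS3.trans hcut.symm).le)
    intro d hd
    rw [mem_cut] at hd
    rw [mem_image]
    refine ⟨d.1, hd.1, ?_⟩
    by_contra hne
    have h1 := mem_filter.1 hd.1
    have h2 := hlab d h1.1 c h1.2 (fun h => hne (by rw [← h]))
    exact hd.2 (mem_filter.2 ⟨G.flip_mem d h1.1, h2.1⟩)
  by_contra! hno
  have key : ∀ v ∈ S, G.flip (v, m v) = (o, m o) := by
    intro v hv
    have h1 := mem_filter.1 hv
    have h2 : (v, m v) ∈ G.cut S := by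
      rw [hcutS, mem_image]
      exact ⟨v, hv, by rw [hno v h1.1 h1.2]⟩
    rw [mem_cut] at h2
    have h3 : (G.flip (v, m v)).1 ∈ G.verts \ S := mem_sdiff.2 ⟨G.flip_mem _ h1.1, h2.2⟩
    rw [ho, mem_singleton] at h3
    have h4 := hm (v, m v) h1.1 rfl
    rw [h3] at h4
    exact Prod.ext h3 h4.symm
  obtain ⟨v, hv, w, hw, hvw⟩ := one_lt_card.1 (by omega : 1 < S.card)
  have := G.flip_inj (hSW hv) (hSW hw) ((key v hv).trans (key w hw).symm)
  exact hvw (congrArg Prod.fst this)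

theorem Bridgeless.solvable_of_card_le_four [DecidableEq L] {G : CubicMultigraph V}
    (hG : G.Bridgeless) (hcard : G.verts.card ≤ 4) {lab : V → Option L} {ext : V → Fin 3}
    (hlab : G.IsLabelling lab ext) {e : V × Fin 3} (he : e.1 ∈ G.verts) :
    G.Solvable lab ext e := by
  set z := (G.flip e).1 with hz
  have hzW : z ∈ G.verts := G.flip_mem e he
  have hza : z ≠ e.1 := hG.no_loop he
  have hpair : ({e.1, z} : Finset V) ⊆ G.verts := by
    intro v hv; simp only [mem_insert, mem_singleton] at hv; rcases hv with rfl | rfl <;> assumption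
  have hpc : ({e.1, z} : Finset V).card = 2 := card_pair hza.symm
  have hev := G.even_card_verts
  have h2 := card_le_card hpair
  have h24 : G.verts.card = 2 ∨ G.verts.card = 4 := by
    obtain ⟨k, hk⟩ := hev; omega
  rcases h24 with h2' | h4
  · have hW := eq_of_subset_of_card_le hpair (by omega)
    refine ⟨fun v => if v = e.1 then e.2 else (G.flip e).2, ?_, by simp, ?_⟩
    · intro d hd hm
      have hd' := hd
      rw [← hW] at hd
      simp only [mem_insert, mem_singleton] at hd
      rcases hd with hd | hd
      · simp only [hd, if_true] at hm
        have : d = e := Prod.ext hd hm.symm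
        subst this
        simp [← hz, hza]
      · simp only [hd, hza, if_false] at hm
        have : d = G.flip e := Prod.ext hd hm.symm
        subst this
        simp [G.flip_flip e he]
    · intro c hc
      have h3 := hlab.three_le_card hG hc
      have := card_le_card (filter_subset (fun v => lab v = some c) G.verts)
      omega
  · set R := G.verts \ {e.1, z} with hR
    have hRW : R ⊆ G.verts := sdiff_subset
    have hRc : R.card = 2 := by rw [hR, card_sdiff_of_subset hpair]; omega
    obtain ⟨f, hf, hf'⟩ : ∃ f : V × Fin 3, f.1 ∈ R ∧ (G.flip f).1 ∈ R := by
      by_contra! hno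
      have h1 : G.cut R = R ×ˢ univ := by
        ext d
        simp only [mem_cut, mem_product, mem_univ, and_true, and_iff_left_iff_imp]
        exact hno d
      have h6 : (G.cut {e.1, z}).card = 6 := by
        rw [← G.card_cut_compl hpair, ← hR, h1, card_product, hRc]; simp
      have h7 : G.cut {e.1, z} ⊆ (({e.1, z} : Finset V) ×ˢ univ).erase e := by
        intro d hd
        rw [mem_cut] at hd
        refine mem_erase.2 ⟨?_, by simpa using hd.1⟩
        rintro rfl
        exact hd.2 (by simp [hz])
      have h8 := card_le_card h7
      rw [card_erase_of_mem (by simp), card_product, hpc, h6] at h8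
      simp at h8
    have hff : (G.flip f).1 ≠ f.1 := hG.no_loop (hRW hf)
    have hRe : ({f.1, (G.flip f).1} : Finset V) = R :=
      eq_of_subset_of_card_le (by
        intro v hv; simp only [mem_insert, mem_singleton] at hv
        rcases hv with rfl | rfl <;> assumption) (by rw [card_pair hff.symm]; omega)
    rw [hR] at hf hf'
    simp only [mem_sdiff, mem_insert, mem_singleton, not_or] at hf hf'
    obtain ⟨hfW, hfa, hfz⟩ := hf
    obtain ⟨hfW', hfa', hfz'⟩ := hf'
    obtain ⟨m, hma, hmz, hmf, hmf'⟩ : ∃ m : V → Fin 3, m e.1 = e.2 ∧ m z = (G.flip e).2 ∧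
        m f.1 = f.2 ∧ m (G.flip f).1 = (G.flip f).2 := by
      refine ⟨fun v => if v = e.1 then e.2 else if v = z then (G.flip e).2 else
        if v = f.1 then f.2 else (G.flip f).2, ?_⟩
      simp [hza, hfa, hfz, hfa', hfz', hff]
    have hm : G.IsMatching m := by
      intro d hd hdm
      have hcases : d.1 = e.1 ∨ d.1 = z ∨ d.1 = f.1 ∨ d.1 = (G.flip f).1 := by
        by_cases h : d.1 ∈ ({e.1, z} : Finset V)
        · simp only [mem_insert, mem_singleton] at h; tauto
        · have : d.1 ∈ R := mem_sdiff.2 ⟨hd, h⟩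
          rw [← hRe] at this
          simp only [mem_insert, mem_singleton] at this; tauto
      rcases hcases with h | h | h | h <;> rw [h] at hdm
      · obtain rfl : d = e := Prod.ext h (hdm.symm.trans hma)
        exact hmz
      · obtain rfl : d = G.flip e := Prod.ext h (hdm.symm.trans hmz)
        rw [G.flip_flip e he]; exact hma
      · obtain rfl : d = f := Prod.ext h (hdm.symm.trans hmf)
        exact hmf'
      · obtain rfl : d = G.flip f := Prod.ext h (hdm.symm.trans hmf')
        rw [G.flip_flip f hfW]; exact hmf
    exact ⟨m, hm, hma, fun c hc => hG.hits_of_card_eq_four h4 hlab hm hc⟩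

end

/-! ### Contracting a side of a cut of size three -/

section

variable {V L : Type*} [DecidableEq V]

/-- `g` numbers the darts leaving `X` by `Fin 3`, with inverse `idx`. -/
structure CutNumbering (G : CubicMultigraph V) (X : Finset V) (g : Fin 3 → V × Fin 3)
    (idx : V × Fin 3 → Fin 3) : Prop where
  subset : X ⊆ G.verts
  mem : ∀ i, g i ∈ G.cut X
  idx_g : ∀ i, idx (g i) = i
  g_idx : ∀ d ∈ G.cut X, g (idx d) = d

theorem exists_cutNumbering (G : CubicMultigraph V) {X : Finset V} (hX : X ⊆ G.verts)
    (h3 : (G.cut X).card = 3) : ∃ g idx, G.CutNumbering X g idx := by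
  let f := (Finset.equivFinOfCardEq h3)
  refine ⟨fun i => (f.symm i).1, fun d => if h : d ∈ G.cut X then f ⟨d, h⟩ else 0, hX,
    fun i => (f.symm i).2, fun i => ?_, fun d hd => ?_⟩
  · simp
  · simp [hd]

namespace CutNumbering

variable {G : CubicMultigraph V} {X : Finset V} {g : Fin 3 → V × Fin 3} {idx : V × Fin 3 → Fin 3}

theorem fst_mem (h : G.CutNumbering X g idx) (i : Fin 3) : (g i).1 ∈ X :=
  (mem_cut.1 (h.mem i)).1

theorem fst_mem_verts (h : G.CutNumbering X g idx) (i : Fin 3) : (g i).1 ∈ G.verts :=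
  h.subset (h.fst_mem i)

theorem flip_notMem (h : G.CutNumbering X g idx) (i : Fin 3) : (G.flip (g i)).1 ∉ X :=
  (mem_cut.1 (h.mem i)).2

theorem compl (h : G.CutNumbering X g idx) :
    G.CutNumbering (G.verts \ X) (fun i => G.flip (g i)) (fun d => idx (G.flip d)) where
  subset := sdiff_subset
  mem i := by
    rw [mem_cut, G.flip_flip _ (h.fst_mem_verts i)]
    exact ⟨mem_sdiff.2 ⟨G.flip_mem _ (h.fst_mem_verts i), h.flip_notMem i⟩,
      fun h' => (mem_sdiff.1 h').2 (h.fst_mem i)⟩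
  idx_g i := by
    rw [G.flip_flip _ (h.fst_mem_verts i), h.idx_g]
  g_idx d hd := by
    rw [mem_cut, mem_sdiff, mem_sdiff] at hd
    have h1 := G.flip_mem d hd.1.1
    rw [h.g_idx, G.flip_flip d hd.1.1]
    rw [mem_cut, G.flip_flip d hd.1.1]
    exact ⟨by tauto, hd.1.2⟩

/-- The multigraph obtained by contracting the complement of `X` to the vertex `o`. -/
def contract (h : G.CutNumbering X g idx) {o : V} (ho : o ∉ X) : CubicMultigraph V where
  verts := insert o X
  flip d := if d.1 = o then g d.2 else if (G.flip d).1 ∈ X then G.flip d else (o, idx d)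
  flip_flip d hd := by
    rw [mem_insert] at hd
    by_cases hdo : d.1 = o
    · have h1 : (g d.2).1 ≠ o := fun h' => ho (h' ▸ h.fst_mem d.2)
      simp only [hdo, if_true, h1, if_false, h.flip_notMem, h.idx_g]
      rw [← hdo]
    · have hdX : d.1 ∈ X := hd.resolve_left hdo
      by_cases h2 : (G.flip d).1 ∈ X
      · have h3 : (G.flip d).1 ≠ o := fun h' => ho (h' ▸ h2)
        simp [hdo, h2, h3, G.flip_flip d (h.subset hdX), hdX]
      · simp [hdo, h2, h.g_idx d (mem_cut.2 ⟨hdX, h2⟩)]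
  flip_mem d hd := by
    rw [mem_insert] at hd ⊢
    by_cases hdo : d.1 = o
    · simp [hdo, h.fst_mem]
    · by_cases h2 : (G.flip d).1 ∈ X <;> simp [hdo, h2]
  flip_ne d hd := by
    rw [mem_insert] at hd
    by_cases hdo : d.1 = o
    · simp only [hdo, if_true]
      intro h'
      exact ho (hdo ▸ h' ▸ h.fst_mem d.2)
    · by_cases h2 : (G.flip d).1 ∈ X
      · simpa [hdo, h2] using G.flip_ne d (h.subset (hd.resolve_left hdo))
      · simp only [hdo, h2, if_false]
        intro h'
        exact hdo (by rw [← h'])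

variable {o : V}

theorem contract_verts (h : G.CutNumbering X g idx) (ho : o ∉ X) :
    (h.contract ho).verts = insert o X := rfl

theorem contract_flip_base (h : G.CutNumbering X g idx) (ho : o ∉ X) (i : Fin 3) :
    (h.contract ho).flip (o, i) = g i := by
  simp [contract]

theorem contract_flip_of_mem (h : G.CutNumbering X g idx) (ho : o ∉ X) {d : V × Fin 3}
    (hd : d.1 ∈ X) (hd' : (G.flip d).1 ∈ X) : (h.contract ho).flip d = G.flip d := by
  have : d.1 ≠ o := fun h' => ho (h' ▸ hd)
  simp [contract, this, hd']

theorem contract_flip_g (h : G.CutNumbering X g idx) (ho : o ∉ X) (i : Fin 3) :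
    (h.contract ho).flip (g i) = (o, i) := by
  have : (g i).1 ≠ o := fun h' => ho (h' ▸ h.fst_mem i)
  simp [contract, this, h.flip_notMem, h.idx_g]

theorem bridgeless_contract (h : G.CutNumbering X g idx) (ho : o ∉ X) (hG : G.Bridgeless) :
    (h.contract ho).Bridgeless := by
  have key : ∀ Y ⊆ X, ((h.contract ho).cut Y).card ≠ 1 := by
    intro Y hY
    have : (h.contract ho).cut Y = G.cut Y := by
      ext d
      rw [mem_cut, mem_cut]
      refine and_congr_right fun hd => ?_
      by_cases h2 : (G.flip d).1 ∈ X
      · rw [h.contract_flip_of_mem ho (hY hd) h2]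
      · have h1 := h.g_idx d (mem_cut.2 ⟨hY hd, h2⟩)
        rw [← h1, h.contract_flip_g ho, h1]
        exact ⟨fun _ h' => h2 (hY h'), fun _ h' => ho (hY h')⟩
    rw [this]
    exact hG Y (hY.trans h.subset)
  intro Y hY
  by_cases hoY : o ∈ Y
  · rw [← (h.contract ho).card_cut_compl hY]
    refine key _ fun v hv => ?_
    rw [contract_verts, mem_sdiff, mem_insert] at hv
    rcases hv with ⟨rfl | hv, hv'⟩
    · exact absurd hoY hv'
    · exact hv
  · refine key _ fun v hv => ?_
    have := hY hv
    rw [contract_verts, mem_insert] at this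
    exact this.resolve_left fun h' => hoY (h' ▸ hv)

/-- The label and the distinguished dart of the contracted vertex are compatible with the labelling
along the cut. -/
def Compatible (g : Fin 3 → V × Fin 3) (lab : V → Option L) (ext : V → Fin 3)
    (lo : Option L) (eo : Fin 3) : Prop :=
  ∀ i c, (lo = some c ∧ i ≠ eo) ↔ (lab (g i).1 = some c ∧ (g i).2 ≠ ext (g i).1)

theorem Compatible.compl {lab : V → Option L} {ext : V → Fin 3} {lo : Option L} {eo : Fin 3}
    (h : G.CutNumbering X g idx) (hlab : G.IsLabelling lab ext)
    (hc : Compatible g lab ext lo eo) : Compatible (fun i => G.flip (g i)) lab ext lo eo := by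
  intro i c
  rw [hc i c]
  refine ⟨fun h' => hlab _ (h.fst_mem_verts i) c h'.1 h'.2, fun h' => ?_⟩
  have := hlab _ (G.flip_mem _ (h.fst_mem_verts i)) c h'.1 h'.2
  rwa [G.flip_flip _ (h.fst_mem_verts i)] at this

theorem exists_compatible [DecidableEq L] {lab : V → Option L} {ext : V → Fin 3}
    (h : G.CutNumbering X g idx) (hlab : G.IsLabelling lab ext) :
    ∃ lo eo, Compatible g lab ext lo eo := by
  have heven : ∀ c, Even (univ.filter fun i =>
      lab (g i).1 = some c ∧ (g i).2 ≠ ext (g i).1).card := by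
    intro c
    convert G.even_card_crossing hlab h.subset c using 1
    refine Finset.card_nbij' g idx ?_ ?_ ?_ ?_
    · intro i hi
      simp only [coe_filter, mem_univ, true_and, Set.mem_ofPred_eq] at hi ⊢
      exact ⟨h.mem i, hi⟩
    · intro d hd
      simp only [coe_filter, mem_univ, true_and, Set.mem_ofPred_eq] at hd ⊢
      rw [h.g_idx d hd.1]; exact hd.2
    · intro i _; exact h.idx_g i
    · intro d hd
      simp only [coe_filter, Set.mem_ofPred_eq] at hd
      exact h.g_idx d hd.1
  by_cases hex : ∃ i c, lab (g i).1 = some c ∧ (g i).2 ≠ ext (g i).1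
  · obtain ⟨i, c, hic⟩ := hex
    obtain ⟨eo, heo⟩ : ∃ eo, ∀ j, (lab (g j).1 = some c ∧ (g j).2 ≠ ext (g j).1) ↔ j ≠ eo := by
      have key : ∀ s : Finset (Fin 3), Even s.card → s.Nonempty → ∃ eo, ∀ j, j ∈ s ↔ j ≠ eo := by
        decide
      obtain ⟨eo, heo⟩ := key _ (heven c) ⟨i, by simpa using hic⟩
      exact ⟨eo, fun j => by simpa using heo j⟩
    refine ⟨some c, eo, fun j c' => ?_⟩
    constructor
    · rintro ⟨hcc, hj⟩
      cases hcc
      exact (heo j).2 hj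
    · intro hj
      by_cases hje : j = eo
      · exfalso
        have hcc : c' ≠ c := fun hcc => (heo j).1 (hcc ▸ hj) hje
        have h1 : (univ.filter fun i => lab (g i).1 = some c' ∧ (g i).2 ≠ ext (g i).1) = {j} := by
          ext k
          simp only [mem_filter, mem_univ, true_and, mem_singleton]
          refine ⟨fun hk => ?_, fun hk => hk ▸ hj⟩
          by_contra hkj
          have := (heo k).2 (hje ▸ hkj)
          rw [this.1] at hk
          exact hcc (Option.some.inj hk.1).symm
        have := heven c'
        rw [h1] at this
        simp at this
      · have := (heo j).2 hje
        rw [this.1] at hj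
        exact ⟨hj.1, hje⟩
  · push Not at hex
    refine ⟨none, 0, fun i c => ⟨fun h' => by simp at h', fun h' => absurd (hex i c h'.1) h'.2⟩⟩

variable {lab : V → Option L} {ext : V → Fin 3} {lo : Option L} {eo : Fin 3}

theorem isLabelling_contract (h : G.CutNumbering X g idx) (ho : o ∉ X)
    (hlab : G.IsLabelling lab ext) (hc : Compatible g lab ext lo eo) :
    (h.contract ho).IsLabelling (Function.update lab o lo) (Function.update ext o eo) := by
  intro d hd c hdc hde
  rw [contract_verts, mem_insert] at hd
  have hne : ∀ v ∈ X, v ≠ o := fun v hv h' => ho (h' ▸ hv)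
  by_cases hdo : d.1 = o
  · obtain ⟨v, i⟩ := d
    simp only at hdo; subst hdo
    rw [h.contract_flip_base ho]
    simp only [Function.update_self] at hdc hde
    have := hne _ (h.fst_mem i)
    simp only [Function.update_of_ne this]
    exact (hc i c).1 ⟨hdc, hde⟩
  · have hdX := hd.resolve_left hdo
    rw [Function.update_of_ne hdo] at hdc hde
    by_cases h2 : (G.flip d).1 ∈ X
    · rw [h.contract_flip_of_mem ho hdX h2]
      simp only [Function.update_of_ne (hne _ h2)]
      exact hlab d (h.subset hdX) c hdc hde
    · have h1 := h.g_idx d (mem_cut.2 ⟨hdX, h2⟩)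
      rw [← h1, h.contract_flip_g ho]
      simp only [Function.update_self]
      exact (hc _ c).2 (h1.symm ▸ ⟨hdc, hde⟩)

theorem exists_hit_of_contract [DecidableEq L] (h : G.CutNumbering X g idx) (ho : o ∉ X)
    (hc : Compatible g lab ext lo eo) {m : V → Fin 3} (hm : (h.contract ho).IsMatching m)
    {c : L} (hit : ∃ v ∈ (h.contract ho).verts, Function.update lab o lo v = some c ∧
      m v ≠ Function.update ext o eo v) :
    ∃ v ∈ X, lab v = some c ∧ m v ≠ ext v := by
  obtain ⟨v, hv, hvc, hve⟩ := hit
  by_cases hvo : v = o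
  · subst hvo
    simp only [Function.update_self] at hvc hve
    have h1 := (hc (m v) c).1 ⟨hvc, hve⟩
    have h2 := hm (v, m v) hv rfl
    rw [h.contract_flip_base ho] at h2
    exact ⟨_, h.fst_mem _, h1.1, h2.symm ▸ h1.2⟩
  · rw [Function.update_of_ne hvo] at hvc hve
    exact ⟨v, (mem_insert.1 hv).resolve_left hvo, hvc, hve⟩

theorem card_filter_contract [DecidableEq L] (h : G.CutNumbering X g idx) (ho : o ∉ X) (c : L) :
    ((h.contract ho).verts.filter fun v => Function.update lab o lo v = some c).card =
      (X.filter fun v => lab v = some c).card + if lo = some c then 1 else 0 := by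
  rw [contract_verts, filter_insert, Function.update_self]
  have : X.filter (fun v => Function.update lab o lo v = some c) =
      X.filter fun v => lab v = some c := by
    refine filter_congr fun v hv => ?_
    rw [Function.update_of_ne fun h' : v = o => ho (h' ▸ hv)]
  rw [this]
  split_ifs
  · rw [card_insert_of_notMem]
    simp [ho]
  · rfl

end CutNumbering

/-- Every smaller bridgeless multigraph has a matching through any edge meeting every odd class. -/
def SolvableBelow (L : Type*) [DecidableEq L] (G : CubicMultigraph V) : Prop :=
  ∀ G' : CubicMultigraph V, G'.verts.card < G.verts.card → G'.Bridgeless →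
    ∀ (lab : V → Option L) (ext : V → Fin 3), G'.IsLabelling lab ext →
      ∀ e : V × Fin 3, e.1 ∈ G'.verts → G'.Solvable lab ext e

theorem Bridgeless.solvable_of_cutNumbering [DecidableEq L] {G : CubicMultigraph V}
    (hG : G.Bridgeless) (ih : G.SolvableBelow L) {lab : V → Option L} {ext : V → Fin 3}
    (hlab : G.IsLabelling lab ext)
    {X : Finset V} {g : Fin 3 → V × Fin 3} {idx : V × Fin 3 → Fin 3}
    (h : G.CutNumbering X g idx) (hX : 1 < X.card) (hX' : 1 < (G.verts \ X).card)
    {e : V × Fin 3} (he : e.1 ∈ X) : G.Solvable lab ext e := by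
  have hsum := card_sdiff_add_card_eq_card h.subset
  obtain ⟨lo, eo, hc⟩ := h.exists_compatible hlab
  have hc' := hc.compl h hlab
  have h' := h.compl
  obtain ⟨o, ho⟩ : (G.verts \ X).Nonempty := card_pos.1 (by omega)
  obtain ⟨o', ho'⟩ : X.Nonempty := card_pos.1 (by omega)
  have hoX := (mem_sdiff.1 ho).2
  have hoX' : o' ∉ G.verts \ X := fun h' => (mem_sdiff.1 h').2 ho'
  obtain ⟨m₁, hm₁, hme, hhit₁⟩ := ih (h.contract hoX)
    (by rw [h.contract_verts, card_insert_of_notMem hoX]; omega)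
    (h.bridgeless_contract hoX hG) _ _ (h.isLabelling_contract hoX hlab hc) e
    (mem_insert_of_mem he)
  obtain ⟨m₂, hm₂, hme₂, hhit₂⟩ := ih (h'.contract hoX')
    (by rw [h'.contract_verts, card_insert_of_notMem hoX']; omega)
    (h'.bridgeless_contract hoX' hG) _ _ (h'.isLabelling_contract hoX' hlab hc') (o', m₁ o)
    (mem_insert_self _ _)
  simp only at hme₂
  refine ⟨fun v => if v ∈ X then m₁ v else m₂ v, ?_, by simp [he, hme], ?_⟩
  · intro d hd hdm
    by_cases hdX : d.1 ∈ X
    · simp only [hdX, if_true] at hdm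
      have h1 := hm₁ d (mem_insert_of_mem hdX) hdm
      by_cases hfX : (G.flip d).1 ∈ X
      · rw [h.contract_flip_of_mem hoX hdX hfX] at h1
        simpa [hfX] using h1
      · have hgi := h.g_idx d (mem_cut.2 ⟨hdX, hfX⟩)
        rw [← hgi, h.contract_flip_g] at h1
        have h2 := hm₂ (o', idx d) (mem_insert_self _ _) (hme₂.trans h1)
        rw [h'.contract_flip_base, hgi] at h2
        simpa [hfX] using h2
    · simp only [hdX, if_false] at hdm
      have hdX' : d.1 ∈ G.verts \ X := mem_sdiff.2 ⟨hd, hdX⟩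
      have h1 := hm₂ d (mem_insert_of_mem hdX') hdm
      by_cases hfX : (G.flip d).1 ∈ X
      · have hgi : G.flip (g (idx (G.flip d))) = d := h'.g_idx d (mem_cut.2 ⟨hdX', by simp [hfX]⟩)
        have hgf := h'.contract_flip_g hoX' (idx (G.flip d))
        simp only [hgi] at hgf
        rw [hgf] at h1
        simp only [hme₂] at h1
        have h2 := hm₁ (o, idx (G.flip d)) (mem_insert_self _ _) h1
        have h3 := h.g_idx (G.flip d) (mem_cut.2 ⟨hfX, by rwa [G.flip_flip d hd]⟩)
        rw [h.contract_flip_base, h3] at h2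
        simpa [hfX] using h2
      · rw [h'.contract_flip_of_mem hoX' hdX' (mem_sdiff.2 ⟨G.flip_mem d hd, hfX⟩)] at h1
        simpa [hfX] using h1
  · intro c hodd
    have hsplit : (G.verts.filter fun v => lab v = some c).card =
        (X.filter fun v => lab v = some c).card +
          ((G.verts \ X).filter fun v => lab v = some c).card := by
      rw [← card_union_of_disjoint (disjoint_filter_filter disjoint_sdiff), ← filter_union,
        union_sdiff_of_subset h.subset]
    have e₁ := h.card_filter_contract hoX (lab := lab) (lo := lo) c
    have e₂ := h'.card_filter_contract hoX' (lab := lab) (lo := lo) c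
    have : Odd ((h.contract hoX).verts.filter fun v => Function.update lab o lo v = some c).card ∨
        Odd ((h'.contract hoX').verts.filter
          fun v => Function.update lab o' lo v = some c).card := by
      grind
    rcases this with h1 | h1
    · obtain ⟨v, hv, hvc, hve⟩ := h.exists_hit_of_contract hoX hc hm₁ (hhit₁ c h1)
      exact ⟨v, h.subset hv, hvc, by simpa [hv] using hve⟩
    · obtain ⟨v, hv, hvc, hve⟩ := h'.exists_hit_of_contract hoX' hc' hm₂ (hhit₂ c h1)
      have := mem_sdiff.1 hv
      exact ⟨v, this.1, hvc, by simpa [this.2] using hve⟩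

theorem Bridgeless.solvable_of_not_threeCutsTrivial [DecidableEq L] {G : CubicMultigraph V}
    (hG : G.Bridgeless) (ih : G.SolvableBelow L) {lab : V → Option L} {ext : V → Fin 3}
    (hlab : G.IsLabelling lab ext) (h3 : ¬ G.ThreeCutsTrivial)
    {e : V × Fin 3} (he : e.1 ∈ G.verts) : G.Solvable lab ext e := by
  unfold ThreeCutsTrivial at h3
  push Not at h3
  obtain ⟨X, hX, hX3, h1, h2⟩ := h3
  obtain ⟨g, idx, h⟩ := G.exists_cutNumbering hX hX3
  by_cases heX : e.1 ∈ X
  · exact hG.solvable_of_cutNumbering ih hlab h h1 h2 heX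
  · exact hG.solvable_of_cutNumbering ih hlab h.compl h2 (by rwa [Finset.sdiff_sdiff_eq_self hX])
      (mem_sdiff.2 ⟨he, heX⟩)

end

/-! ### Multigraphs without nontrivial cuts of size three -/

section

variable {V L : Type*} [DecidableEq V]

/-- A bridgeless multigraph on at least six vertices without nontrivial cuts of size three. -/
structure Tight (G : CubicMultigraph V) : Prop where
  bridgeless : G.Bridgeless
  threeCutsTrivial : G.ThreeCutsTrivial
  four_lt : 4 < G.verts.card

namespace Tight

variable {G : CubicMultigraph V}

theorem card_le_one_of_card_cut (hG : G.Tight) {X : Finset V} (hX : X ⊆ G.verts)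
    (h3 : (G.cut X).card ≤ 3) (hodd : Odd (G.cut X).card) :
    X.card ≤ 1 ∨ (G.verts \ X).card ≤ 1 := by
  have := hG.bridgeless X hX
  exact hG.threeCutsTrivial X hX (by obtain ⟨k, hk⟩ := hodd; omega)

theorem card_cut_of_card_eq_three (hG : G.Tight) {X : Finset V} (hX : X ⊆ G.verts)
    (h3 : X.card = 3) : 3 < (G.cut X).card := by
  by_contra! hle
  have hodd : Odd (G.cut X).card := by
    rw [← Nat.not_even_iff_odd, G.even_card_cut_iff hX, h3]; decide
  have h1 := hG.card_le_one_of_card_cut hX hle hodd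
  have h2 := card_sdiff_add_card_eq_card hX
  have h4 := hG.four_lt
  omega

theorem no_double (hG : G.Tight) {d d' : V × Fin 3} (hd : d.1 ∈ G.verts) (hdd' : d.1 = d'.1)
    (hne : d ≠ d') : (G.flip d).1 ≠ (G.flip d').1 := by
  intro h
  obtain ⟨k, hk⟩ : ∃ k, ∀ i, i = d.2 ∨ i = d'.2 ∨ i = k := by
    have : d.2 ≠ d'.2 := fun h' => hne (Prod.ext hdd' h')
    generalize d.2 = i at *
    generalize d'.2 = j at *
    revert i j; decide
  obtain ⟨X, hX₁, hX, hX3⟩ := exists_subsuperset_card_eq (n := 3)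
    (s := {d.1, (G.flip d).1, (G.flip (d.1, k)).1}) (t := G.verts)
    (by
      intro v hv
      simp only [mem_insert, mem_singleton] at hv
      rcases hv with rfl | rfl | rfl
      exacts [hd, G.flip_mem _ hd, G.flip_mem (d.1, k) hd])
    card_le_three (by have := hG.four_lt; omega)
  have hd1 : d.1 ∈ X := hX₁ (by simp)
  have hnb : ∀ i, (G.flip (d.1, i)).1 ∈ X := by
    intro i
    rcases hk i with rfl | rfl | rfl
    · exact hX₁ (by simp)
    · rw [hdd', ← h]; exact hX₁ (by simp)
    · exact hX₁ (by simp)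
  have hlt := hG.card_cut_of_card_eq_three hX hX3
  set I : Finset (V × Fin 3) := ({d.1} : Finset V) ×ˢ univ with hI
  have hIm : ∀ x ∈ I, x.1 = d.1 := fun x hx => mem_singleton.1 (mem_product.1 hx).1
  have hdisj : Disjoint I (I.image G.flip) := by
    rw [disjoint_left]
    intro x hx hx'
    obtain ⟨y, hy, rfl⟩ := mem_image.1 hx'
    have h1 := hIm _ hx
    have h2 := hIm _ hy
    exact hG.bridgeless.no_loop (h2 ▸ hd) (h1.trans h2.symm)
  have hinj : Set.InjOn G.flip I := fun x hx y hy hxy =>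
    G.flip_inj (hIm x hx ▸ hd) (hIm y hy ▸ hd) hxy
  have hsub : G.cut X ⊆ (X ×ˢ univ) \ (I ∪ I.image G.flip) := by
    intro x hx
    rw [mem_cut] at hx
    rw [mem_sdiff, mem_union, not_or]
    refine ⟨by simpa using hx.1, fun h1 => hx.2 ?_, fun h1 => hx.2 ?_⟩
    · have := hIm x h1
      obtain ⟨x1, x2⟩ := x
      simp only at this; subst this
      exact hnb x2
    · obtain ⟨y, hy, rfl⟩ := mem_image.1 h1
      rw [G.flip_flip y (hIm y hy ▸ hd), hIm y hy]; exact hd1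
  have hsub' : I ∪ I.image G.flip ⊆ X ×ˢ univ := by
    intro x hx
    simp only [mem_product, mem_univ, and_true]
    rcases mem_union.1 hx with hx | hx
    · rw [hIm x hx]; exact hd1
    · obtain ⟨y, hy, rfl⟩ := mem_image.1 hx
      have := hIm y hy
      obtain ⟨y1, y2⟩ := y
      simp only at this; subst this
      exact hnb y2
  have hcard := card_le_card hsub
  rw [card_sdiff_of_subset hsub', card_union_of_disjoint hdisj, card_image_of_injOn hinj] at hcard
  simp [hI, hX3] at hcard
  omega

theorem no_triangle (hG : G.Tight) {d d' f : V × Fin 3} (hd : d.1 ∈ G.verts) (hdd' : d.1 = d'.1)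
    (hne : d ≠ d') (hf : f.1 = (G.flip d).1) : (G.flip f).1 ≠ (G.flip d').1 := by
  intro h
  have hd' : d'.1 ∈ G.verts := hdd' ▸ hd
  have hvW := G.flip_mem d hd
  have hwW := G.flip_mem d' hd'
  have hfW : f.1 ∈ G.verts := hf ▸ hvW
  have huv := hG.bridgeless.no_loop hd
  have huw : (G.flip d').1 ≠ d.1 := hdd' ▸ hG.bridgeless.no_loop hd'
  have hvw := hG.no_double hd hdd' hne
  set X : Finset V := {d.1, (G.flip d).1, (G.flip d').1} with hX
  have hXW : X ⊆ G.verts := by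
    intro v hv
    simp only [hX, mem_insert, mem_singleton] at hv
    rcases hv with rfl | rfl | rfl <;> assumption
  have hX3 : X.card = 3 := card_eq_three.2 ⟨_, _, _, huv.symm, huw.symm, hvw, rfl⟩
  have hlt := hG.card_cut_of_card_eq_three hXW hX3
  set I : Finset (V × Fin 3) := {d, G.flip d, d', G.flip d', f, G.flip f} with hI
  have hI6 : I.card = 6 := by
    have n1 : d ≠ G.flip d := fun h' => huv (by rw [← h'])
    have n2 : d ≠ G.flip d' := fun h' => huw (by rw [← h'])
    have n3 : d ≠ f := fun h' => huv (by rw [← hf, ← h'])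
    have n4 : d ≠ G.flip f := fun h' => huw (by rw [← h, ← h'])
    have n5 : G.flip d ≠ d' := fun h' => huv (by rw [h', hdd'])
    have n6 : G.flip d ≠ G.flip d' := fun h' => hvw (by rw [h'])
    have n7 : G.flip d ≠ f := fun h' => huw (by rw [← h, ← h', G.flip_flip d hd])
    have n8 : G.flip d ≠ G.flip f := fun h' => n3 (G.flip_inj hd hfW h')
    have n9 : d' ≠ G.flip d' := fun h' => huw (by rw [← h', hdd'])
    have n10 : d' ≠ f := fun h' => huv (by rw [← hf, ← h', hdd'])
    have n11 : d' ≠ G.flip f := fun h' => huw (by rw [← h, ← h', hdd'])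
    have n12 : G.flip d' ≠ f := fun h' => hvw (by rw [h', hf])
    have n13 : G.flip d' ≠ G.flip f := fun h' => n10 (G.flip_inj hd' hfW h')
    have n14 : f ≠ G.flip f := fun h' => hvw (by rw [← h, ← h', hf])
    simp only [hI]
    repeat rw [card_insert_of_notMem (by simp only [mem_insert, mem_singleton]; tauto)]
    simp
  have hmemX : ∀ v, v ∈ X ↔ v = d.1 ∨ v = (G.flip d).1 ∨ v = (G.flip d').1 := by
    intro v; simp [hX]
  have hcl : ∀ x ∈ I, x.1 ∈ X ∧ (G.flip x).1 ∈ X := by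
    intro x hx
    simp only [hI, mem_insert, mem_singleton] at hx
    rw [hmemX, hmemX]
    rcases hx with rfl | rfl | rfl | rfl | rfl | rfl
    · simp
    · simp [G.flip_flip _ hd]
    · simp [hdd']
    · simp [G.flip_flip _ hd', hdd']
    · simp [hf, h]
    · simp [G.flip_flip _ hfW, hf, h]
  have hsub : G.cut X ⊆ (X ×ˢ univ) \ I := by
    intro x hx
    rw [mem_cut] at hx
    exact mem_sdiff.2 ⟨by simpa using hx.1, fun h1 => hx.2 (hcl x h1).2⟩
  have hsub' : I ⊆ X ×ˢ univ := fun x hx => by simpa using (hcl x hx).1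
  have hcard := card_le_card hsub
  rw [card_sdiff_of_subset hsub', hI6] at hcard
  simp [hX3] at hcard
  omega

end Tight

end

/-! ### Deleting vertices and joining the dangling edges -/

section

variable {V L : Type*} [DecidableEq V]

/-- `D` enumerates in pairs the darts leaving the vertex set `S`. -/
structure Suppression (G : CubicMultigraph V) (S : Finset V) {n : ℕ}
    (D : Fin n × Bool → V × Fin 3) : Prop where
  subset : S ⊆ G.verts
  fst_mem : ∀ k, (D k).1 ∈ S
  flip_notMem : ∀ k, (G.flip (D k)).1 ∉ S
  injective : Function.Injective D
  exists_eq : ∀ d, d.1 ∈ S → (G.flip d).1 ∉ S → ∃ k, D k = d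

namespace Suppression

variable {G : CubicMultigraph V} {S : Finset V} {n : ℕ} {D : Fin n × Bool → V × Fin 3}

omit [DecidableEq V] in
theorem fst_mem_verts (h : G.Suppression S D) (k : Fin n × Bool) : (D k).1 ∈ G.verts :=
  h.subset (h.fst_mem k)

omit [DecidableEq V] in
theorem exists_eq_flip (h : G.Suppression S D) {d : V × Fin 3} (hd : d.1 ∈ G.verts)
    (hdS : d.1 ∉ S) (hfS : (G.flip d).1 ∈ S) : ∃ k, d = G.flip (D k) := by
  obtain ⟨k, hk⟩ := h.exists_eq (G.flip d) hfS (by rwa [G.flip_flip d hd])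
  exact ⟨k, by rw [hk, G.flip_flip d hd]⟩

open Classical in
/-- The dart paired by `D` with a given dart. -/
noncomputable def partner (D : Fin n × Bool → V × Fin 3) (d : V × Fin 3) : V × Fin 3 :=
  if h : ∃ k, D k = d then D (h.choose.1, !h.choose.2) else d

theorem partner_apply (h : G.Suppression S D) (k : Fin n × Bool) :
    partner D (D k) = D (k.1, !k.2) := by
  have hex : ∃ k', D k' = D k := ⟨k, rfl⟩
  have : hex.choose = k := h.injective hex.choose_spec
  rw [partner, dif_pos hex, this]

open Classical in
/-- The multigraph obtained by deleting `S` and joining the dangling edges as paired by `D`. -/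
noncomputable def suppress (h : G.Suppression S D) : CubicMultigraph V where
  verts := G.verts \ S
  flip d := if (G.flip d).1 ∈ S then G.flip (partner D (G.flip d)) else G.flip d
  flip_flip d hd := by
    rw [mem_sdiff] at hd
    by_cases hf : (G.flip d).1 ∈ S
    · obtain ⟨k, rfl⟩ := h.exists_eq_flip hd.1 hd.2 hf
      simp only [G.flip_flip _ (h.fst_mem_verts _), h.partner_apply, h.fst_mem, if_true,
        Bool.not_not]
    · simp [hf, G.flip_flip d hd.1, hd.2]
  flip_mem d hd := by
    rw [mem_sdiff] at hd ⊢
    by_cases hf : (G.flip d).1 ∈ S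
    · obtain ⟨k, rfl⟩ := h.exists_eq_flip hd.1 hd.2 hf
      simp only [G.flip_flip _ (h.fst_mem_verts _), h.partner_apply, h.fst_mem, if_true]
      exact ⟨G.flip_mem _ (h.fst_mem_verts _), h.flip_notMem _⟩
    · simp [hf, G.flip_mem d hd.1]
  flip_ne d hd := by
    rw [mem_sdiff] at hd
    by_cases hf : (G.flip d).1 ∈ S
    · obtain ⟨k, rfl⟩ := h.exists_eq_flip hd.1 hd.2 hf
      simp only [G.flip_flip _ (h.fst_mem_verts _), h.partner_apply, h.fst_mem, if_true]
      intro h'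
      have := congrArg Prod.snd
        (h.injective (G.flip_inj (h.fst_mem_verts _) (h.fst_mem_verts _) h'))
      simp at this
    · simpa [hf] using G.flip_ne d hd.1

theorem suppress_verts (h : G.Suppression S D) : h.suppress.verts = G.verts \ S := rfl

theorem suppress_flip_of_notMem (h : G.Suppression S D) {d : V × Fin 3}
    (hd : (G.flip d).1 ∉ S) : h.suppress.flip d = G.flip d := by
  simp [suppress, hd]

theorem suppress_flip_flip (h : G.Suppression S D) (k : Fin n × Bool) :
    h.suppress.flip (G.flip (D k)) = G.flip (D (k.1, !k.2)) := by
  simp [suppress, G.flip_flip _ (h.fst_mem_verts _), h.partner_apply, h.fst_mem]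

theorem flip_mem_suppress (h : G.Suppression S D) (k : Fin n × Bool) :
    (G.flip (D k)).1 ∈ h.suppress.verts :=
  mem_sdiff.2 ⟨G.flip_mem _ (h.fst_mem_verts k), h.flip_notMem k⟩

theorem matching_iff (h : G.Suppression S D) {m : V → Fin 3} (hm : h.suppress.IsMatching m)
    (i : Fin n) : m (G.flip (D (i, true))).1 = (G.flip (D (i, true))).2 ↔
      m (G.flip (D (i, false))).1 = (G.flip (D (i, false))).2 := by
  constructor
  · intro h'
    have := hm _ (h.flip_mem_suppress _) h'
    rwa [h.suppress_flip_flip] at this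
  · intro h'
    have := hm _ (h.flip_mem_suppress _) h'
    rwa [h.suppress_flip_flip] at this

theorem isMatching_of_suppress (h : G.Suppression S D) {m m' : V → Fin 3}
    (hm' : h.suppress.IsMatching m') (heq : ∀ v ∉ S, m v = m' v)
    (hD : ∀ k, m (D k).1 = (D k).2 ↔ m' (G.flip (D k)).1 = (G.flip (D k)).2)
    (hS : ∀ d, d.1 ∈ S → (G.flip d).1 ∈ S → m d.1 = d.2 → m (G.flip d).1 = (G.flip d).2) :
    G.IsMatching m := by
  intro d hd hdm
  by_cases hdS : d.1 ∈ S
  · by_cases hfS : (G.flip d).1 ∈ S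
    · exact hS d hdS hfS hdm
    · obtain ⟨k, rfl⟩ := h.exists_eq d hdS hfS
      rw [heq _ hfS]
      exact (hD k).1 hdm
  · rw [heq _ hdS] at hdm
    by_cases hfS : (G.flip d).1 ∈ S
    · obtain ⟨k, rfl⟩ := h.exists_eq_flip hd hdS hfS
      rw [G.flip_flip _ (h.fst_mem_verts k)]
      exact (hD k).2 hdm
    · rw [heq _ hfS]
      have := hm' d (mem_sdiff.2 ⟨hd, hdS⟩) hdm
      rwa [h.suppress_flip_of_notMem hfS] at this

/-- The darts leaving both `X` and the deleted vertices. -/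
def old (G : CubicMultigraph V) (S X : Finset V) : Finset (V × Fin 3) :=
  (G.cut X).filter fun d => (G.flip d).1 ∉ S

theorem card_cut (h : G.Suppression S D) {X : Finset V} (hX : X ⊆ G.verts \ S) :
    (G.cut X).card = (old G S X).card + ∑ i,
      ((if (G.flip (D (i, true))).1 ∈ X then 1 else 0) +
        if (G.flip (D (i, false))).1 ∈ X then 1 else 0) := by
  have h1 : ((G.cut X).filter fun d => (G.flip d).1 ∈ S).card =
      (univ.filter fun k => (G.flip (D k)).1 ∈ X).card := by
    symm
    refine Finset.card_bij (fun k _ => G.flip (D k)) ?_ ?_ ?_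
    · intro k hk
      simp only [mem_filter, mem_univ, true_and] at hk
      rw [mem_filter, mem_cut, G.flip_flip _ (h.fst_mem_verts k)]
      exact ⟨⟨hk, fun h' => (mem_sdiff.1 (hX h')).2 (h.fst_mem k)⟩, h.fst_mem k⟩
    · intro k _ k' _ hkk
      exact h.injective (G.flip_inj (h.fst_mem_verts _) (h.fst_mem_verts _) hkk)
    · intro d hd
      rw [mem_filter, mem_cut] at hd
      have hd' := mem_sdiff.1 (hX hd.1.1)
      obtain ⟨k, rfl⟩ := h.exists_eq_flip hd'.1 hd'.2 hd.2
      exact ⟨k, by simpa using hd.1.1, rfl⟩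
  rw [← card_filter_add_card_filter_not (s := G.cut X) fun d => (G.flip d).1 ∈ S, h1, add_comm,
    old, card_filter _ (univ : Finset (Fin n × Bool)), Fintype.sum_prod_type]
  simp only [Fintype.sum_bool]

theorem card_cut_suppress (h : G.Suppression S D) {X : Finset V} (hX : X ⊆ G.verts \ S) :
    (h.suppress.cut X).card = (old G S X).card + ∑ i,
      ((if (G.flip (D (i, true))).1 ∈ X ∧ (G.flip (D (i, false))).1 ∉ X then 1 else 0) +
        if (G.flip (D (i, false))).1 ∈ X ∧ (G.flip (D (i, true))).1 ∉ X then 1 else 0) := by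
  have h1 : ((h.suppress.cut X).filter fun d => (G.flip d).1 ∈ S).card =
      (univ.filter fun k => (G.flip (D k)).1 ∈ X ∧ (G.flip (D (k.1, !k.2))).1 ∉ X).card := by
    symm
    refine Finset.card_bij (fun k _ => G.flip (D k)) ?_ ?_ ?_
    · intro k hk
      simp only [mem_filter, mem_univ, true_and] at hk
      rw [mem_filter, mem_cut, h.suppress_flip_flip, G.flip_flip _ (h.fst_mem_verts k)]
      exact ⟨hk, h.fst_mem k⟩
    · intro k _ k' _ hkk
      exact h.injective (G.flip_inj (h.fst_mem_verts _) (h.fst_mem_verts _) hkk)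
    · intro d hd
      rw [mem_filter, mem_cut] at hd
      have hd' := mem_sdiff.1 (hX hd.1.1)
      obtain ⟨k, rfl⟩ := h.exists_eq_flip hd'.1 hd'.2 hd.2
      rw [h.suppress_flip_flip] at hd
      exact ⟨k, by simpa using hd.1, rfl⟩
  have h2 : (h.suppress.cut X).filter (fun d => (G.flip d).1 ∉ S) = old G S X := by
    ext d
    rw [old, mem_filter, mem_filter, mem_cut, mem_cut]
    refine and_congr_left fun hd => ?_
    rw [h.suppress_flip_of_notMem hd]
  rw [← card_filter_add_card_filter_not (s := h.suppress.cut X) fun d => (G.flip d).1 ∈ S, h1, h2,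
    add_comm, card_filter _ (univ : Finset (Fin n × Bool)), Fintype.sum_prod_type]
  simp only [Fintype.sum_bool, Bool.not_true, Bool.not_false]

theorem card_old_compl (G : CubicMultigraph V) {S X : Finset V} (hX : X ⊆ G.verts \ S) :
    (old G S ((G.verts \ S) \ X)).card = (old G S X).card := by
  have hmem : ∀ {Y d}, d ∈ old G S Y ↔ d.1 ∈ Y ∧ (G.flip d).1 ∉ Y ∧ (G.flip d).1 ∉ S := by
    intro Y d; rw [old, mem_filter, mem_cut, and_assoc]
  refine Finset.card_nbij' G.flip G.flip ?_ ?_ ?_ ?_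
  · intro d hd
    simp only [mem_coe, hmem, mem_sdiff, not_and, not_not] at hd ⊢
    rw [G.flip_flip d hd.1.1.1]
    exact ⟨hd.2.1 ⟨G.flip_mem d hd.1.1.1, hd.2.2⟩, hd.1.2, hd.1.1.2⟩
  · intro d hd
    simp only [mem_coe, hmem, mem_sdiff, not_and, not_not] at hd ⊢
    have h0 := mem_sdiff.1 (hX hd.1)
    rw [G.flip_flip d h0.1]
    exact ⟨⟨⟨G.flip_mem d h0.1, hd.2.2⟩, hd.2.1⟩, fun _ => hd.1, h0.2⟩
  · intro d hd
    simp only [mem_coe, hmem, mem_sdiff] at hd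
    exact G.flip_flip d hd.1.1.1
  · intro d hd
    simp only [mem_coe, hmem] at hd
    exact G.flip_flip d (mem_sdiff.1 (hX hd.1)).1

theorem card_cut_compl (h : G.Suppression S D) {X : Finset V} (hX : X ⊆ G.verts \ S) :
    (G.cut ((G.verts \ S) \ X)).card = (old G S X).card + ∑ i,
      ((if (G.flip (D (i, true))).1 ∉ X then 1 else 0) +
        if (G.flip (D (i, false))).1 ∉ X then 1 else 0) := by
  rw [h.card_cut sdiff_subset, card_old_compl G hX]
  have := h.flip_mem_suppress
  rw [h.suppress_verts] at this
  simp only [mem_sdiff (s := G.verts \ S), this, true_and]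

theorem card_le_one (h : G.Suppression S D) (hG : G.Tight) (hS : 1 < S.card) {X : Finset V}
    (hX : X ⊆ G.verts \ S) (h3 : (G.cut X).card = 3) : X.card ≤ 1 := by
  refine (hG.threeCutsTrivial X (hX.trans sdiff_subset) h3).resolve_right fun h' => ?_
  have : S ⊆ G.verts \ X := fun v hv =>
    mem_sdiff.2 ⟨h.subset hv, fun hv' => (mem_sdiff.1 (hX hv')).2 hv⟩
  have := card_le_card this
  omega

theorem bridgeless_of_two {D : Fin 2 × Bool → V × Fin 3} (h : G.Suppression S D) (hG : G.Tight)
    (hS : S.card = 2) : h.suppress.Bridgeless := by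
  intro X hX h1
  rw [h.suppress_verts] at hX
  have e1 := h.card_cut_suppress hX
  have e2 := h.card_cut hX
  have e3 := h.card_cut_compl hX
  have hX' : (G.verts \ S) \ X ⊆ G.verts \ S := sdiff_subset
  have b2 := hG.bridgeless X (hX.trans sdiff_subset)
  have b3 := hG.bridgeless _ (hX'.trans sdiff_subset)
  have c2 := h.card_le_one hG (by omega) hX
  have c3 := h.card_le_one hG (by omega) hX'
  have s1 := card_sdiff_add_card_eq_card h.subset
  have s2 := card_sdiff_add_card_eq_card hX
  have s3 := hG.four_lt
  rw [h1] at e1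
  rw [Fin.sum_univ_two] at e1 e2 e3
  by_cases q1 : (G.flip (D (0, true))).1 ∈ X <;> by_cases q2 : (G.flip (D (0, false))).1 ∈ X <;>
  by_cases q3 : (G.flip (D (1, true))).1 ∈ X <;> by_cases q4 : (G.flip (D (1, false))).1 ∈ X <;>
  simp only [q1, q2, q3, q4, if_true, if_false, not_true, not_false_eq_true, and_true, and_false]
    at e1 e2 e3 <;> omega

theorem bridgeless_of_three {D : Fin 3 × Bool → V × Fin 3} (h : G.Suppression S D) (hG : G.Tight)
    (hS : 1 < S.card)
    (hne : ∀ i, (G.flip (D (i, true))).1 ≠ (G.flip (D (i, false))).1)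
    {e : V × Fin 3} (he : e.1 ∈ G.verts) (heS : e.1 ∉ S) (hfS : (G.flip e).1 ∉ S) :
    h.suppress.Bridgeless := by
  intro X hX h1
  rw [h.suppress_verts] at hX
  have e1 := h.card_cut_suppress hX
  have e2 := h.card_cut hX
  have e3 := h.card_cut_compl hX
  have hX' : (G.verts \ S) \ X ⊆ G.verts \ S := sdiff_subset
  have b2 := hG.bridgeless X (hX.trans sdiff_subset)
  have b3 := hG.bridgeless _ (hX'.trans sdiff_subset)
  have c2 := h.card_le_one hG hS hX
  have c3 := h.card_le_one hG hS hX'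
  rw [h1] at e1
  have hloop := hG.bridgeless.no_loop he
  have heW : e.1 ∈ G.verts \ S := mem_sdiff.2 ⟨he, heS⟩
  have hfW : (G.flip e).1 ∈ G.verts \ S := mem_sdiff.2 ⟨G.flip_mem e he, hfS⟩
  have k1 : (old G S X).card = 0 → (G.cut X).card = 3 → (G.cut ((G.verts \ S) \ X)).card ≠ 3 := by
    intro o0 g2 g3
    have c2 := Finset.card_le_one.1 (c2 g2)
    have c3 := Finset.card_le_one.1 (c3 g3)
    have o1 : ∀ d, d ∉ old G S X := by rw [card_eq_zero] at o0; simp [o0]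
    have o2 := o1 e
    have o3 := o1 (G.flip e)
    simp only [old, mem_filter, mem_cut, G.flip_flip e he] at o2 o3
    by_cases t1 : e.1 ∈ X <;> by_cases t2 : (G.flip e).1 ∈ X
    · exact hloop (c2 _ t2 _ t1)
    · exact o2 ⟨⟨t1, t2⟩, hfS⟩
    · exact o3 ⟨⟨t2, t1⟩, heS⟩
    · exact hloop (c3 _ (mem_sdiff.2 ⟨hfW, t2⟩) _ (mem_sdiff.2 ⟨heW, t1⟩))
  have k2 : (G.cut X).card = 3 → ∀ i, (G.flip (D (i, true))).1 ∈ X →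
      (G.flip (D (i, false))).1 ∉ X := fun g i t1 t2 =>
    hne i (Finset.card_le_one.1 (c2 g) _ t1 _ t2)
  have k3 : (G.cut ((G.verts \ S) \ X)).card = 3 → ∀ i, (G.flip (D (i, true))).1 ∉ X →
      (G.flip (D (i, false))).1 ∈ X := by
    intro g i t1
    by_contra t2
    exact hne i (Finset.card_le_one.1 (c3 g) _ (mem_sdiff.2 ⟨h.flip_mem_suppress _, t1⟩) _
      (mem_sdiff.2 ⟨h.flip_mem_suppress _, t2⟩))
  obtain ⟨T, hT⟩ : ∃ T : Fin 3 → ℕ, ∀ i, T i = (if (G.flip (D (i, true))).1 ∈ X then 1 else 0) +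
    if (G.flip (D (i, false))).1 ∈ X then 1 else 0 := ⟨_, fun _ => rfl⟩
  obtain ⟨U, hU⟩ : ∃ U : Fin 3 → ℕ, ∀ i, U i = (if (G.flip (D (i, true))).1 ∉ X then 1 else 0) +
    if (G.flip (D (i, false))).1 ∉ X then 1 else 0 := ⟨_, fun _ => rfl⟩
  obtain ⟨Z, hZ⟩ : ∃ Z : Fin 3 → ℕ, ∀ i, Z i =
    (if (G.flip (D (i, true))).1 ∈ X ∧ (G.flip (D (i, false))).1 ∉ X then 1 else 0) +
    if (G.flip (D (i, false))).1 ∈ X ∧ (G.flip (D (i, true))).1 ∉ X then 1 else 0 :=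
    ⟨_, fun _ => rfl⟩
  simp only [← hT, ← hU, ← hZ, Fin.sum_univ_three] at e1 e2 e3
  have key : ∀ i, (T i + U i = 2 ∧ (Z i = 0 ∧ T i ≠ 1 ∨ Z i = 1 ∧ T i = 1)) ∧
      ((G.cut X).card = 3 → T i ≠ 2) ∧ ((G.cut ((G.verts \ S) \ X)).card = 3 → U i ≠ 2) := by
    intro i
    rw [hT, hU, hZ]
    by_cases q1 : (G.flip (D (i, true))).1 ∈ X <;> by_cases q2 : (G.flip (D (i, false))).1 ∈ X
    · simpa [q1, q2] using fun g => k2 g i q1 q2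
    · simp [q1, q2]
    · simp [q1, q2]
    · simpa [q1, q2] using fun g => q2 (k3 g i q1)
  obtain ⟨⟨y0, y0'⟩, p0, p0'⟩ := key 0
  obtain ⟨⟨y1, y1'⟩, p1, p1'⟩ := key 1
  obtain ⟨⟨y2, y2'⟩, p2, p2'⟩ := key 2
  clear key k2 k3 c2 c3 hne hT hU hZ
  generalize T 0 = T0 at *
  generalize T 1 = T1 at *
  generalize T 2 = T2 at *
  generalize U 0 = U0 at *
  generalize U 1 = U1 at *
  generalize U 2 = U2 at *
  generalize Z 0 = Z0 at *
  generalize Z 1 = Z1 at *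
  generalize Z 2 = Z2 at *
  generalize (old G S X).card = o at *
  generalize (G.cut X).card = x at *
  generalize (G.cut ((G.verts \ S) \ X)).card = x' at *
  clear hloop hX hX' heW hfW h1 he heS hfS hS hG
  rcases y0' with ⟨z0, w0⟩ | ⟨z0, w0⟩ <;> rcases y1' with ⟨z1, w1⟩ | ⟨z1, w1⟩ <;>
  rcases y2' with ⟨z2, w2⟩ | ⟨z2, w2⟩ <;> subst z0 z1 z2 <;>
  omega

theorem exists_matching [DecidableEq L] (h : G.Suppression S D) (hS : S.Nonempty)
    (ih : G.SolvableBelow L) (hb : h.suppress.Bridgeless) {lab : V → Option L} {ext : V → Fin 3}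
    (hlab : G.IsLabelling lab ext) {k : Option L} (hk : ∀ v ∈ S, lab v = none ∨ lab v = k)
    {e : V × Fin 3} (he : e.1 ∈ G.verts) (heS : e.1 ∉ S) :
    ∃ m, h.suppress.IsMatching m ∧ m e.1 = e.2 ∧
      ∀ c, some c ≠ k → Odd (G.verts.filter fun v => lab v = some c).card →
        ∃ v ∈ G.verts, v ∉ S ∧ lab v = some c ∧ m v ≠ ext v := by
  set lab' : V → Option L := fun v => if lab v = k then none else lab v with hlab'
  have hl : ∀ v c, lab' v = some c ↔ lab v = some c ∧ some c ≠ k := by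
    intro v c
    simp only [hlab']
    split_ifs with h1
    · grind
    · grind
  have hnS : ∀ v c, lab' v = some c → v ∉ S := by
    intro v c hv hvS
    rw [hl] at hv
    rcases hk v hvS with h1 | h1 <;> rw [hv.1] at h1
    · simp at h1
    · exact hv.2 h1
  have hlt : h.suppress.verts.card < G.verts.card := by
    rw [h.suppress_verts, card_sdiff_of_subset h.subset]
    have := card_le_card h.subset
    have := hS.card_pos
    omega
  have hlabelling : h.suppress.IsLabelling lab' ext := by
    intro d hd c hdc hde
    have h1 := (hl _ _).1 hdc
    have h2 := hlab d (mem_sdiff.1 hd).1 c h1.1 hde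
    have h3 : lab' (G.flip d).1 = some c := (hl _ _).2 ⟨h2.1, h1.2⟩
    rw [h.suppress_flip_of_notMem (hnS _ _ h3)]
    exact ⟨h3, h2.2⟩
  obtain ⟨m, hm, hme, hhit⟩ := ih _ hlt hb lab' ext hlabelling e (mem_sdiff.2 ⟨he, heS⟩)
  refine ⟨m, hm, hme, fun c hck hodd => ?_⟩
  have hfil : h.suppress.verts.filter (fun v => lab' v = some c) =
      G.verts.filter fun v => lab v = some c := by
    ext v
    rw [mem_filter, mem_filter, suppress_verts, mem_sdiff]
    constructor
    · rintro ⟨h1, h2⟩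
      exact ⟨h1.1, ((hl _ _).1 h2).1⟩
    · rintro ⟨h1, h2⟩
      have h3 := (hl v c).2 ⟨h2, hck⟩
      exact ⟨⟨h1, hnS _ _ h3⟩, h3⟩
  obtain ⟨v, hv, hvc, hve⟩ := hhit c (by rwa [hfil])
  exact ⟨v, (mem_sdiff.1 hv).1, (mem_sdiff.1 hv).2, ((hl _ _).1 hvc).1, hve⟩

end Suppression

end

/-! ### Deleting the ends of an edge -/

section

variable {V L : Type*}

theorem eq_or_eq_or_eq : ∀ {i₀ i₁ i₂ : Fin 3}, i₀ ≠ i₁ → i₀ ≠ i₂ → i₁ ≠ i₂ → ∀ i,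
    i = i₀ ∨ i = i₁ ∨ i = i₂ := by
  decide

/-- An edge from `x` to `y`, with names for the other darts at its ends. -/
structure Link (G : CubicMultigraph V) (x y : V) (i₀ i₁ i₂ j₀ j₁ j₂ : Fin 3) : Prop where
  mem : x ∈ G.verts
  i₀₁ : i₀ ≠ i₁
  i₀₂ : i₀ ≠ i₂
  i₁₂ : i₁ ≠ i₂
  j₀₁ : j₀ ≠ j₁
  j₀₂ : j₀ ≠ j₂
  j₁₂ : j₁ ≠ j₂
  flip_eq : G.flip (x, i₁) = (y, j₀)

namespace Link

variable {G : CubicMultigraph V} {x y : V} {i₀ i₁ i₂ j₀ j₁ j₂ : Fin 3}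

theorem mem' (h : G.Link x y i₀ i₁ i₂ j₀ j₁ j₂) : y ∈ G.verts := by
  have := G.flip_mem (x, i₁) h.mem
  rwa [h.flip_eq] at this

theorem flip_eq' (h : G.Link x y i₀ i₁ i₂ j₀ j₁ j₂) : G.flip (y, j₀) = (x, i₁) := by
  rw [← h.flip_eq, G.flip_flip _ h.mem]

theorem cases_left (h : G.Link x y i₀ i₁ i₂ j₀ j₁ j₂) (i : Fin 3) : i = i₀ ∨ i = i₁ ∨ i = i₂ :=
  eq_or_eq_or_eq h.i₀₁ h.i₀₂ h.i₁₂ i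

theorem cases_right (h : G.Link x y i₀ i₁ i₂ j₀ j₁ j₂) (j : Fin 3) : j = j₀ ∨ j = j₁ ∨ j = j₂ :=
  eq_or_eq_or_eq h.j₀₁ h.j₀₂ h.j₁₂ j

theorem symm (h : G.Link x y i₀ i₁ i₂ j₀ j₁ j₂) : G.Link y x j₁ j₀ j₂ i₁ i₀ i₂ where
  mem := h.mem'
  i₀₁ := h.j₀₁.symm
  i₀₂ := h.j₁₂
  i₁₂ := h.j₀₂
  j₀₁ := h.i₀₁.symm
  j₀₂ := h.i₁₂
  j₁₂ := h.i₀₂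
  flip_eq := h.flip_eq'

/-- A choice of darts at the ends of a link avoiding the first pair of darts leaving it. -/
theorem exists_choice (h : G.Link x y i₀ i₁ i₂ j₀ j₁ j₂) (P : Prop) :
    ∃ s t, (s = i₁ ∧ t = j₀ ∨ s = i₂ ∧ t = j₂) ∧ (s = i₂ ↔ P) ∧ (t = j₂ ↔ P) ∧
      (s = i₁ → t = j₀) ∧ (t = j₀ → s = i₁) ∧ s ≠ i₀ ∧ t ≠ j₁ := by
  by_cases hP : P
  · exact ⟨i₂, j₂, by simp, by simp [hP], by simp [hP], fun h' => absurd h'.symm h.i₁₂,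
      fun h' => absurd h'.symm h.j₀₂, h.i₀₂.symm, h.j₁₂.symm⟩
  · exact ⟨i₁, j₀, by simp, by simp [hP, h.i₁₂], by simp [hP, h.j₀₂], by simp, by simp,
      h.i₀₁.symm, h.j₀₁⟩

variable [DecidableEq V]

theorem ne (h : G.Link x y i₀ i₁ i₂ j₀ j₁ j₂) (hG : G.Tight) : x ≠ y := by
  have := hG.bridgeless.no_loop (d := (x, i₁)) h.mem
  rw [h.flip_eq] at this
  exact this.symm

theorem flip_left_ne (h : G.Link x y i₀ i₁ i₂ j₀ j₁ j₂) (hG : G.Tight) {i : Fin 3} (hi : i ≠ i₁) :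
    (G.flip (x, i)).1 ≠ x ∧ (G.flip (x, i)).1 ≠ y := by
  refine ⟨hG.bridgeless.no_loop (d := (x, i)) h.mem, fun h' => ?_⟩
  refine hG.no_double (d := (x, i)) (d' := (x, i₁)) h.mem rfl (by simpa using hi) ?_
  rw [h', h.flip_eq]

theorem flip_right_ne (h : G.Link x y i₀ i₁ i₂ j₀ j₁ j₂) (hG : G.Tight) {j : Fin 3} (hj : j ≠ j₀) :
    (G.flip (y, j)).1 ≠ x ∧ (G.flip (y, j)).1 ≠ y :=
  (h.symm.flip_left_ne hG hj).symm

/-- The darts leaving a link, paired. -/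
def darts (x y : V) (i₀ i₂ j₁ j₂ : Fin 3) (k : Fin 2 × Bool) : V × Fin 3 :=
  if k.2 then (x, if k.1 = 0 then i₀ else i₂) else (y, if k.1 = 0 then j₁ else j₂)

theorem suppression (h : G.Link x y i₀ i₁ i₂ j₀ j₁ j₂) (hG : G.Tight) :
    G.Suppression {x, y} (darts x y i₀ i₂ j₁ j₂) where
  subset v hv := by
    simp only [mem_insert, mem_singleton] at hv
    rcases hv with rfl | rfl
    exacts [h.mem, h.mem']
  fst_mem k := by
    simp only [darts]; split_ifs <;> simp
  flip_notMem k := by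
    simp only [mem_insert, mem_singleton, not_or, darts]
    split_ifs
    exacts [h.flip_left_ne hG h.i₀₁, h.flip_left_ne hG h.i₁₂.symm,
      h.flip_right_ne hG h.j₀₁.symm, h.flip_right_ne hG h.j₀₂.symm]
  injective k k' hkk := by
    have h1 := h.ne hG
    have h2 := h1.symm
    have h3 := h.i₀₂
    have h4 := h.i₀₂.symm
    have h5 := h.j₁₂
    have h6 := h.j₁₂.symm
    obtain ⟨i, b⟩ := k
    obtain ⟨i', b'⟩ := k'
    fin_cases i <;> fin_cases i' <;> cases b <;> cases b' <;> simp_all [darts]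
  exists_eq d hd hf := by
    obtain ⟨v, i⟩ := d
    simp only [mem_insert, mem_singleton] at hd
    rcases hd with rfl | rfl
    · rcases h.cases_left i with rfl | rfl | rfl
      · exact ⟨(0, true), by simp [darts]⟩
      · simp [h.flip_eq] at hf
      · exact ⟨(1, true), by simp [darts]⟩
    · rcases h.cases_right i with rfl | rfl | rfl
      · simp [h.flip_eq'] at hf
      · exact ⟨(0, false), by simp [darts]⟩
      · exact ⟨(1, false), by simp [darts]⟩

theorem exists_isMatching (h : G.Link x y i₀ i₁ i₂ j₀ j₁ j₂) (hG : G.Tight) {m : V → Fin 3}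
    (hm : (h.suppression hG).suppress.IsMatching m)
    (h0 : m (G.flip (x, i₀)).1 ≠ (G.flip (x, i₀)).2) :
    ∃ m', G.IsMatching m' ∧ (∀ v ∉ ({x, y} : Finset V), m' v = m v) ∧
      (m' x = i₁ ∧ m' y = j₀ ∨ m' x = i₂ ∧ m' y = j₂) := by
  have hxy := h.ne hG
  have e0 := (h.suppression hG).matching_iff hm 0
  have e1 := (h.suppression hG).matching_iff hm 1
  simp only [darts, if_true, Bool.false_eq_true, if_false, one_ne_zero] at e0 e1
  obtain ⟨s, t, hst, hs, ht, hst', hts, hs0, ht1⟩ :=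
    h.exists_choice (m (G.flip (x, i₂)).1 = (G.flip (x, i₂)).2)
  refine ⟨fun v => if v = x then s else if v = y then t else m v, ?_, ?_, ?_⟩
  · refine (h.suppression hG).isMatching_of_suppress hm ?_ ?_ ?_
    · intro v hv
      simp only [mem_insert, mem_singleton, not_or] at hv
      simp [hv]
    · rintro ⟨i, b⟩
      fin_cases i <;> cases b
      · simp [darts, hxy.symm, ht1, ← e0, h0]
      · simp [darts, hs0, h0]
      · simp [darts, hxy.symm, ht, ← e1]
      · simp [darts, hs]
    · rintro ⟨v, i⟩ hd hf hdm
      simp only [mem_insert, mem_singleton] at hd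
      simp only at hdm
      rcases hd with rfl | rfl
      · rcases h.cases_left i with rfl | rfl | rfl
        · simp only [if_true] at hdm; exact absurd hdm hs0
        · simp only [if_true] at hdm
          simp [h.flip_eq, hxy.symm, hst' hdm]
        · have := h.flip_left_ne hG h.i₁₂.symm
          simp [this] at hf
      · simp only [hxy.symm, if_true, if_false] at hdm
        rcases h.cases_right i with rfl | rfl | rfl
        · simp [h.flip_eq', hts hdm]
        · exact absurd hdm ht1
        · have := h.flip_right_ne hG h.j₀₂.symm
          simp [this] at hf
  · intro v hv
    simp only [mem_insert, mem_singleton, not_or] at hv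
    simp [hv]
  · simpa [hxy.symm] using hst

theorem solvable [DecidableEq L] (h : G.Link x y i₀ i₁ i₂ j₀ j₁ j₂) (hG : G.Tight)
    (ih : G.SolvableBelow L) {lab : V → Option L} {ext : V → Fin 3} (hlab : G.IsLabelling lab ext)
    {e : V × Fin 3} (he : e.1 ∈ G.verts) (hex : e.1 ≠ x) (hey : e.1 ≠ y)
    (hp : (G.flip (x, i₀)).1 = e.1) (hpe : G.flip (x, i₀) ≠ e)
    {k : Option L} (hx : lab x = none ∨ lab x = k) (hy : lab y = none ∨ lab y = k)
    (hhit : ∀ c, k = some c → ∀ m, G.IsMatching m → (m x = i₁ ∧ m y = j₀ ∨ m x = i₂ ∧ m y = j₂) →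
      ∃ v ∈ G.verts, lab v = some c ∧ m v ≠ ext v) :
    G.Solvable lab ext e := by
  have hS := h.suppression hG
  have heS : e.1 ∉ ({x, y} : Finset V) := by simp [hex, hey]
  obtain ⟨m, hm, hme, hmc⟩ := hS.exists_matching ⟨x, by simp⟩ ih
    (hS.bridgeless_of_two hG (card_pair (h.ne hG))) hlab (k := k) (by simp [hx, hy]) he heS
  obtain ⟨m', hm', heq, hcase⟩ := h.exists_isMatching hG hm (by
    intro h'
    rw [hp, hme] at h'
    exact hpe (Prod.ext hp h'.symm))
  refine ⟨m', hm', by rw [heq _ heS, hme], fun c hc => ?_⟩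
  by_cases hck : k = some c
  · exact hhit c hck m' hm' hcase
  · obtain ⟨v, hv, hvS, hvc, hve⟩ := hmc c (Ne.symm hck) hc
    exact ⟨v, hv, hvc, by rwa [heq v hvS]⟩

end Link

end

/-! ### Deleting the vertices of a path -/

section

variable {V L : Type*}

/-- Two links, from `x` to `y` and from `u` to `w`, with exactly one edge between them, which
joins `y` to `u`. -/
structure LinkPath (G : CubicMultigraph V) (x y u w : V)
    (i₀ i₁ i₂ j₀ j₁ j₂ k₀ k₁ k₂ l₀ l₁ l₂ : Fin 3) : Prop where
  left : G.Link x y i₀ i₁ i₂ j₀ j₁ j₂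
  right : G.Link u w k₀ k₁ k₂ l₀ l₁ l₂
  flip_eq : G.flip (y, j₁) = (u, k₀)
  xu : x ≠ u
  xw : x ≠ w
  yu : y ≠ u
  yw : y ≠ w
  eq_of_flip : ∀ d : V × Fin 3, d.1 = x ∨ d.1 = y → (G.flip d).1 = u ∨ (G.flip d).1 = w →
    d = (y, j₁)

namespace LinkPath

variable {G : CubicMultigraph V} {x y u w : V} {i₀ i₁ i₂ j₀ j₁ j₂ k₀ k₁ k₂ l₀ l₁ l₂ : Fin 3}

theorem flip_eq' (h : G.LinkPath x y u w i₀ i₁ i₂ j₀ j₁ j₂ k₀ k₁ k₂ l₀ l₁ l₂) :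
    G.flip (u, k₀) = (y, j₁) := by
  rw [← h.flip_eq, G.flip_flip _ h.left.mem']

theorem eq_of_flip' (h : G.LinkPath x y u w i₀ i₁ i₂ j₀ j₁ j₂ k₀ k₁ k₂ l₀ l₁ l₂)
    (d : V × Fin 3) (hd : d.1 = u ∨ d.1 = w) (hf : (G.flip d).1 = x ∨ (G.flip d).1 = y) :
    d = (u, k₀) := by
  have hdW : d.1 ∈ G.verts := by
    rcases hd with h' | h' <;> rw [h']
    exacts [h.right.mem, h.right.mem']
  have := h.eq_of_flip (G.flip d) hf (by rwa [G.flip_flip d hdW])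
  rw [← h.flip_eq, ← this, G.flip_flip d hdW]

variable [DecidableEq V]

/-- The darts leaving a path of links, paired. -/
def darts (x y u w : V) (i₀ i₂ j₂ k₂ l₁ l₂ : Fin 3) (k : Fin 3 × Bool) : V × Fin 3 :=
  if k.2 then (if k.1 = 0 then (x, i₀) else if k.1 = 1 then (x, i₂) else (u, k₂))
  else (if k.1 = 0 then (w, l₁) else if k.1 = 1 then (y, j₂) else (w, l₂))

theorem suppression (h : G.LinkPath x y u w i₀ i₁ i₂ j₀ j₁ j₂ k₀ k₁ k₂ l₀ l₁ l₂) (hG : G.Tight) :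
    G.Suppression {x, y, u, w} (darts x y u w i₀ i₂ j₂ k₂ l₁ l₂) where
  subset v hv := by
    simp only [mem_insert, mem_singleton] at hv
    rcases hv with rfl | rfl | rfl | rfl
    exacts [h.left.mem, h.left.mem', h.right.mem, h.right.mem']
  fst_mem k := by
    simp only [darts]; split_ifs <;> simp
  flip_notMem k := by
    have hl : ∀ d : V × Fin 3, d.1 = x ∨ d.1 = y → (G.flip d).1 ≠ x ∧ (G.flip d).1 ≠ y →
        d ≠ (y, j₁) → (G.flip d).1 ∉ ({x, y, u, w} : Finset V) := by
      intro d hd hf hne hmem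
      simp only [mem_insert, mem_singleton] at hmem
      exact hne (h.eq_of_flip d hd (by tauto))
    have hr : ∀ d : V × Fin 3, d.1 = u ∨ d.1 = w → (G.flip d).1 ≠ u ∧ (G.flip d).1 ≠ w →
        d ≠ (u, k₀) → (G.flip d).1 ∉ ({x, y, u, w} : Finset V) := by
      intro d hd hf hne hmem
      simp only [mem_insert, mem_singleton] at hmem
      exact hne (h.eq_of_flip' d hd (by tauto))
    have hxy := h.left.ne hG
    have huw := h.right.ne hG
    simp only [darts]
    split_ifs
    · exact hl _ (by simp) (h.left.flip_left_ne hG h.left.i₀₁) (by simp [hxy])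
    · exact hl _ (by simp) (h.left.flip_left_ne hG h.left.i₁₂.symm) (by simp [hxy])
    · exact hr _ (by simp) (h.right.flip_left_ne hG h.right.i₁₂.symm) (by simp [h.right.i₀₂.symm])
    · exact hr _ (by simp) (h.right.flip_right_ne hG h.right.j₀₁.symm) (by simp [huw.symm])
    · exact hl _ (by simp) (h.left.flip_right_ne hG h.left.j₀₂.symm) (by simp [h.left.j₁₂.symm])
    · exact hr _ (by simp) (h.right.flip_right_ne hG h.right.j₀₂.symm) (by simp [huw.symm])
  injective k k' hkk := by
    have h1 := h.left.ne hG
    have h2 := h.xu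
    have h3 := h.xw
    have h4 := h.yu
    have h5 := h.yw
    have h6 := h.right.ne hG
    have h7 := h.left.i₀₂
    have h8 := h.right.j₁₂
    obtain ⟨i, b⟩ := k
    obtain ⟨i', b'⟩ := k'
    fin_cases i <;> fin_cases i' <;> cases b <;> cases b' <;>
      simp [darts, h1, h2, h3, h4, h5, h6, h7, h8, h1.symm, h2.symm, h3.symm, h4.symm, h5.symm,
        h6.symm, h7.symm, h8.symm] at hkk ⊢
  exists_eq d hd hf := by
    obtain ⟨v, i⟩ := d
    simp only [mem_insert, mem_singleton] at hd
    rcases hd with rfl | rfl | rfl | rfl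
    · rcases h.left.cases_left i with rfl | rfl | rfl
      · exact ⟨(0, true), by simp [darts]⟩
      · simp [h.left.flip_eq] at hf
      · exact ⟨(1, true), by simp [darts]⟩
    · rcases h.left.cases_right i with rfl | rfl | rfl
      · simp [h.left.flip_eq'] at hf
      · simp [h.flip_eq] at hf
      · exact ⟨(1, false), by simp [darts]⟩
    · rcases h.right.cases_left i with rfl | rfl | rfl
      · simp [h.flip_eq'] at hf
      · simp [h.right.flip_eq] at hf
      · exact ⟨(2, true), by simp [darts]⟩
    · rcases h.right.cases_right i with rfl | rfl | rfl
      · simp [h.right.flip_eq'] at hf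
      · exact ⟨(0, false), by simp [darts]⟩
      · exact ⟨(2, false), by simp [darts]⟩

theorem exists_isMatching (h : G.LinkPath x y u w i₀ i₁ i₂ j₀ j₁ j₂ k₀ k₁ k₂ l₀ l₁ l₂)
    (hG : G.Tight) {m : V → Fin 3}
    (hm : (h.suppression hG).suppress.IsMatching m)
    (h0 : m (G.flip (x, i₀)).1 ≠ (G.flip (x, i₀)).2) :
    ∃ m', G.IsMatching m' ∧ (∀ v ∉ ({x, y, u, w} : Finset V), m' v = m v) ∧
      (m' u = k₁ ∧ m' w = l₀ ∨ m' u = k₂ ∧ m' w = l₂) := by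
  have hS := h.suppression hG
  have hxy := h.left.ne hG
  have huw := h.right.ne hG
  have e0 := hS.matching_iff hm 0
  have e1 := hS.matching_iff hm 1
  have e2 := hS.matching_iff hm 2
  have : (2 : Fin 3) ≠ 0 := by decide
  have : (2 : Fin 3) ≠ 1 := by decide
  simp only [darts, if_true, Bool.false_eq_true, if_false, one_ne_zero, *] at e0 e1 e2
  obtain ⟨s, t, hst, hs, ht, hst', hts, hs0, ht1⟩ :=
    h.left.exists_choice (m (G.flip (x, i₂)).1 = (G.flip (x, i₂)).2)
  obtain ⟨s', t', hst₂, hs₂, ht₂, hst₂', hts₂, hs0₂, ht1₂⟩ :=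
    h.right.exists_choice (m (G.flip (u, k₂)).1 = (G.flip (u, k₂)).2)
  obtain ⟨m', mx, my, mu, mw, heq⟩ : ∃ m' : V → Fin 3, m' x = s ∧ m' y = t ∧ m' u = s' ∧ m' w = t' ∧
      ∀ v ∉ ({x, y, u, w} : Finset V), m' v = m v := by
    refine ⟨fun v => if v = x then s else if v = y then t else if v = u then s' else
      if v = w then t' else m v, by simp, by simp [hxy.symm], by simp [h.xu.symm, h.yu.symm],
      by simp [h.xw.symm, h.yw.symm, huw.symm], fun v hv => ?_⟩
    simp only [mem_insert, mem_singleton, not_or] at hv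
    simp [hv]
  refine ⟨m', ?_, heq, by simpa [mu, mw] using hst₂⟩
  refine hS.isMatching_of_suppress hm heq ?_ ?_
  · rintro ⟨i, b⟩
    fin_cases i <;> cases b
    · simp [darts, mw, ht1₂, ← e0]
    · simp [darts, mx, hs0, h0]
    · simp [darts, my, ht, ← e1]
    · simp [darts, mx, hs]
    · simp [darts, mw, ht₂, ← e2]
    · simp [darts, mu, hs₂]
  · rintro ⟨v, i⟩ hd hf hdm
    have hnot : ∀ k, (v, i) ≠ darts x y u w i₀ i₂ j₂ k₂ l₁ l₂ k := by
      intro k hk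
      rw [hk] at hf
      exact hS.flip_notMem k hf
    simp only [mem_insert, mem_singleton] at hd
    simp only at hdm
    rcases hd with rfl | rfl | rfl | rfl
    · rcases h.left.cases_left i with rfl | rfl | rfl
      · exact absurd (hdm.symm.trans mx).symm hs0
      · rw [h.left.flip_eq]; exact my.trans (hst' (mx.symm.trans hdm))
      · exact absurd (by simp [darts]) (hnot (1, true))
    · rcases h.left.cases_right i with rfl | rfl | rfl
      · rw [h.left.flip_eq']; exact mx.trans (hts (my.symm.trans hdm))
      · exact absurd (hdm.symm.trans my).symm ht1
      · exact absurd (by simp [darts]) (hnot (1, false))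
    · rcases h.right.cases_left i with rfl | rfl | rfl
      · exact absurd (hdm.symm.trans mu).symm hs0₂
      · rw [h.right.flip_eq]; exact mw.trans (hst₂' (mu.symm.trans hdm))
      · exact absurd (by simp [darts]) (hnot (2, true))
    · rcases h.right.cases_right i with rfl | rfl | rfl
      · rw [h.right.flip_eq']; exact mu.trans (hts₂ (mw.symm.trans hdm))
      · exact absurd (hdm.symm.trans mw).symm ht1₂
      · exact absurd (by simp [darts]) (hnot (2, false))

theorem solvable [DecidableEq L] (h : G.LinkPath x y u w i₀ i₁ i₂ j₀ j₁ j₂ k₀ k₁ k₂ l₀ l₁ l₂)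
    (hG : G.Tight) (ih : G.SolvableBelow L) {lab : V → Option L} {ext : V → Fin 3}
    (hlab : G.IsLabelling lab ext)
    {e : V × Fin 3} (he : e.1 ∈ G.verts) (heS : e.1 ∉ ({x, y, u, w} : Finset V))
    (hfS : (G.flip e).1 ∉ ({x, y, u, w} : Finset V))
    (hp : (G.flip (x, i₀)).1 = e.1) (hpe : G.flip (x, i₀) ≠ e)
    (hne₀ : (G.flip (w, l₁)).1 ≠ e.1)
    {c : L} (hx : lab x = none) (hy : lab y = some c) (hu : lab u = some c) (hw : lab w = some c)
    (hk₁ : k₁ ≠ ext u) (hl₂ : l₂ ≠ ext w) :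
    G.Solvable lab ext e := by
  have hS := h.suppression hG
  have hb : hS.suppress.Bridgeless := by
    refine hS.bridgeless_of_three hG ?_ ?_ he heS hfS
    · exact one_lt_card.2 ⟨x, by simp, y, by simp, h.left.ne hG⟩
    · intro i
      fin_cases i
      · simpa [darts, hp] using hne₀.symm
      · have := hG.no_triangle (d := (x, i₁)) (d' := (x, i₂)) (f := (y, j₂)) h.left.mem rfl
          (by simp [h.left.i₁₂]) (by rw [h.left.flip_eq])
        simpa [darts] using this.symm
      · have := hG.no_triangle (d := (u, k₁)) (d' := (u, k₂)) (f := (w, l₂)) h.right.mem rfl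
          (by simp [h.right.i₁₂]) (by rw [h.right.flip_eq])
        simpa [darts] using this.symm
  obtain ⟨m, hm, hme, hmc⟩ := hS.exists_matching ⟨x, by simp⟩ ih hb hlab (k := some c)
    (by simp [hx, hy, hu, hw]) he heS
  obtain ⟨m', hm', heq, hcase⟩ := h.exists_isMatching hG hm (by
    intro h'
    rw [hp, hme] at h'
    exact hpe (Prod.ext hp h'.symm))
  refine ⟨m', hm', by rw [heq _ heS, hme], fun c' hc => ?_⟩
  by_cases hck : c' = c
  · subst hck
    rcases hcase with h' | h'
    · exact ⟨u, h.right.mem, hu, h'.1 ▸ hk₁⟩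
    · exact ⟨w, h.right.mem', hw, h'.2 ▸ hl₂⟩
  · obtain ⟨v, hv, hvS, hvc, hve⟩ := hmc c' (by simpa using hck) hc
    exact ⟨v, hv, hvc, by rwa [heq v hvS]⟩

end LinkPath

end

/-! ### The main induction -/

section

variable {V L : Type*}

theorem Solvable.of_flip [DecidableEq L] {G : CubicMultigraph V} {lab : V → Option L}
    {ext : V → Fin 3} {e : V × Fin 3} (he : e.1 ∈ G.verts)
    (h : G.Solvable lab ext (G.flip e)) : G.Solvable lab ext e := by
  obtain ⟨m, hm, hme, hhit⟩ := h
  refine ⟨m, hm, ?_, hhit⟩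
  have := hm _ (G.flip_mem e he) hme
  rwa [G.flip_flip e he] at this

/-- Naming of the darts around the edge `(x, i₁)`. -/
theorem exists_link (G : CubicMultigraph V) {x : V} (hx : x ∈ G.verts) {i₀ i₁ : Fin 3}
    (hi : i₀ ≠ i₁) {j₁ : Fin 3} (hj : (G.flip (x, i₁)).2 ≠ j₁) :
    ∃ i₂ j₂, G.Link x (G.flip (x, i₁)).1 i₀ i₁ i₂ (G.flip (x, i₁)).2 j₁ j₂ := by
  have third : ∀ i j : Fin 3, ∃ k, i ≠ k ∧ j ≠ k := by decide
  obtain ⟨i₂, h1, h2⟩ := third i₀ i₁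
  obtain ⟨j₂, h3, h4⟩ := third (G.flip (x, i₁)).2 j₁
  exact ⟨i₂, j₂, hx, hi, h1, h2, hj, h3, h4, rfl⟩

variable [DecidableEq V]

theorem exists_ne_ne : ∀ i j : Fin 3, ∃ k, i ≠ k ∧ k ≠ j := by decide

namespace Tight

variable [DecidableEq L] {G : CubicMultigraph V} {lab : V → Option L} {ext : V → Fin 3}
  {e p : V × Fin 3}

theorem solvable_of_labelled (hG : G.Tight) (ih : G.SolvableBelow L)
    (hlab : G.IsLabelling lab ext) (he : e.1 ∈ G.verts) (hp : p.1 = e.1) (hpe : p ≠ e) {c : L}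
    (hc : lab (G.flip p).1 = some c) : G.Solvable lab ext e := by
  have hpW : p.1 ∈ G.verts := hp ▸ he
  set x := (G.flip p).1 with hx
  have hxW : x ∈ G.verts := G.flip_mem p hpW
  have hxp : G.flip (x, (G.flip p).2) = p := G.flip_flip p hpW
  obtain ⟨i₁, h01, h1e⟩ := exists_ne_ne (G.flip p).2 (ext x)
  have hy := hlab (x, i₁) hxW c hc h1e
  obtain ⟨i₂, j₂, h⟩ := G.exists_link hxW h01 hy.2
  refine h.solvable hG ih hlab he ?_ ?_ (by rw [hxp, hp]) (by rwa [hxp]) (k := some c)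
    (Or.inr hc) (Or.inr hy.1) ?_
  · rw [← hp]; exact (hG.bridgeless.no_loop hpW).symm
  · have := h.flip_left_ne hG h01
    rw [hxp, hp] at this
    exact this.2
  · intro c' hcc m _ hm
    cases hcc
    rcases hm with hm | hm
    · exact ⟨x, hxW, hc, by rw [hm.1]; exact h1e⟩
    · exact ⟨_, h.mem', hy.1, by rw [hm.2]; exact h.j₁₂.symm⟩

omit [DecidableEq V] [DecidableEq L] in
theorem label_eq_none (hlab : G.IsLabelling lab ext) (he : e.1 ∈ G.verts)
    (hn : ∀ p : V × Fin 3, p.1 = e.1 → p ≠ e → lab (G.flip p).1 = none) : lab e.1 = none := by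
  by_contra h
  obtain ⟨c, hc⟩ := Option.ne_none_iff_exists'.1 h
  obtain ⟨i, h1, h2⟩ := exists_ne_ne e.2 (ext e.1)
  have h3 := (hlab (e.1, i) he c hc h2).1
  rw [hn (e.1, i) rfl (fun h' => h1 (by rw [← h']))] at h3
  simp at h3

theorem solvable_of_unlabelled (hG : G.Tight) (ih : G.SolvableBelow L)
    (hlab : G.IsLabelling lab ext) (he : e.1 ∈ G.verts)
    (ha : ∀ p : V × Fin 3, p.1 = e.1 → p ≠ e → lab (G.flip p).1 = none)
    (hz : lab (G.flip e).1 = none) : G.Solvable lab ext e := by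
  have hla := label_eq_none hlab he ha
  obtain ⟨p, hp, hpe⟩ : ∃ p : V × Fin 3, p.1 = e.1 ∧ p ≠ e := by
    obtain ⟨i, hi⟩ := exists_ne e.2
    exact ⟨(e.1, i), rfl, fun h => hi (by rw [← h])⟩
  have hpW : p.1 ∈ G.verts := hp ▸ he
  have hlx := ha p hp hpe
  set x := (G.flip p).1 with hx
  set i₀ := (G.flip p).2 with hi₀
  have hxW : x ∈ G.verts := G.flip_mem p hpW
  have hxp : G.flip (x, i₀) = p := G.flip_flip p hpW
  have hnone : ∀ {v i c}, v ∈ G.verts → lab v = some c → lab (G.flip (v, i)).1 = none →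
      i = ext v := by
    intro v i c hv hc hn
    by_contra hne
    have := (hlab (v, i) hv c hc hne).1
    rw [hn] at this
    simp at this
  obtain ⟨i₁, h01⟩ := exists_ne i₀
  obtain ⟨j₁, hj₁⟩ := exists_ne (G.flip (x, i₁)).2
  obtain ⟨i₂, j₂, h⟩ := G.exists_link hxW h01.symm hj₁.symm
  set y := (G.flip (x, i₁)).1 with hy
  set j₀ := (G.flip (x, i₁)).2 with hj₀
  have hex : e.1 ≠ x := by rw [← hp]; exact (hG.bridgeless.no_loop hpW).symm
  have hey : e.1 ≠ y := by
    have := h.flip_left_ne hG h.i₀₁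
    rw [hxp, hp] at this
    exact this.2
  have hfp : (G.flip (x, i₀)).1 = e.1 := by rw [hxp, hp]
  have hpe' : G.flip (x, i₀) ≠ e := by rwa [hxp]
  rcases hly : lab y with _ | c
  · exact h.solvable hG ih hlab he hex hey hfp hpe' (k := none)
      (Or.inl hlx) (Or.inl hly) (by simp)
  have hj₀e : j₀ = ext y := hnone h.mem' hly (by rw [h.flip_eq']; exact hlx)
  have hbW : (G.flip (x, i₂)).1 ∈ G.verts := G.flip_mem (x, i₂) hxW
  by_cases hlb : lab (G.flip (x, i₂)).1 = some c
  · refine h.solvable hG ih hlab he hex hey hfp hpe' (k := some c) (Or.inl hlx) (Or.inr hly) ?_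
    intro c' hcc m hm hcase
    cases hcc
    have hbe : (G.flip (x, i₂)).2 = ext (G.flip (x, i₂)).1 :=
      hnone hbW hlb (by rw [Prod.mk.eta, G.flip_flip (x, i₂) hxW]; exact hlx)
    rcases hcase with h' | h'
    · refine ⟨_, hbW, hlb, fun hmb => ?_⟩
      have := hm _ hbW (hmb.trans hbe.symm)
      rw [G.flip_flip (x, i₂) hxW] at this
      exact h.i₁₂ (h'.1.symm.trans this)
    · exact ⟨y, h.mem', hly, by rw [h'.2, ← hj₀e]; exact h.j₀₂.symm⟩
  have hu := hlab (y, j₁) h.mem' c hly (by rw [← hj₀e]; exact hj₁)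
  have huW : (G.flip (y, j₁)).1 ∈ G.verts := G.flip_mem (y, j₁) h.mem'
  have hfu : G.flip ((G.flip (y, j₁)).1, (G.flip (y, j₁)).2) = (y, j₁) := G.flip_flip _ h.mem'
  set u := (G.flip (y, j₁)).1 with hu_def
  set k₀ := (G.flip (y, j₁)).2 with hk₀_def
  obtain ⟨k₁, hk01, hk1e⟩ := exists_ne_ne k₀ (ext u)
  have hw := hlab (u, k₁) huW c hu.1 hk1e
  obtain ⟨k₂, l₂, h'⟩ := G.exists_link huW hk01 hw.2
  set w := (G.flip (u, k₁)).1 with hw_def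
  set l₀ := (G.flip (u, k₁)).2 with hl₀_def
  have hz' : ∀ v, lab v = some c → (G.flip e).1 ≠ v := by
    rintro v hv rfl
    rw [hz] at hv; simp at hv
  have ha' : ∀ v, lab v = some c → e.1 ≠ v := by
    rintro v hv rfl
    rw [hla] at hv; simp at hv
  have hx' : ∀ v, lab v = some c → x ≠ v := by
    rintro v hv rfl
    rw [hlx] at hv; simp at hv
  have hnx : ∀ v, lab v = some c → y ≠ v → ∀ i, (G.flip (x, i)).1 ≠ v := by
    intro v hv hyv i
    rcases h.cases_left i with rfl | rfl | rfl
    · rw [hfp]; exact ha' v hv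
    · exact hyv
    · exact fun hbv => hlb (hbv ▸ hv)
  have hyu := (h.flip_right_ne hG h.j₀₁.symm).2.symm
  have hyw : y ≠ w := by
    have := (h'.flip_left_ne hG h'.i₀₁).2
    rwa [hfu] at this
  have hduw : (G.flip (y, j₂)).1 ≠ u ∧ (G.flip (y, j₂)).1 ≠ w := by
    refine ⟨hG.no_double (d := (y, j₂)) (d' := (y, j₁)) h.mem' rfl (by simp [h.j₁₂.symm]), ?_⟩
    exact (hG.no_triangle (d := (y, j₁)) (d' := (y, j₂)) (f := (u, k₁)) h.mem' rfl
      (by simp [h.j₁₂]) rfl).symm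
  have hpath : G.LinkPath x y u w i₀ i₁ i₂ j₀ j₁ j₂ k₀ k₁ k₂ l₀ (ext w) l₂ := by
    refine ⟨h, h', rfl, hx' u hu.1, hx' w hw.1, hyu, hyw, ?_⟩
    rintro ⟨v, i⟩ (rfl | rfl) hf
    · rcases hf with hf | hf
      · exact absurd hf (hnx u hu.1 hyu i)
      · exact absurd hf (hnx w hw.1 hyw i)
    · rcases h.cases_right i with rfl | rfl | rfl
      · rw [h.flip_eq'] at hf
        rcases hf with hf | hf
        · exact absurd hf (hx' u hu.1)
        · exact absurd hf (hx' w hw.1)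
      · rfl
      · rcases hf with hf | hf
        · exact absurd hf hduw.1
        · exact absurd hf hduw.2
  have hzx : (G.flip e).1 ≠ x := hG.no_double he hp.symm hpe.symm
  have hww : w ∈ G.verts := h'.mem'
  refine hpath.solvable hG ih hlab he ?_ ?_ hfp hpe' ?_ hlx hly hu.1 hw.1 hk1e h'.j₁₂.symm
  · simp [hex, hey, ha' u hu.1, ha' w hw.1]
  · simp [hzx, hz' y hly, hz' u hu.1, hz' w hw.1]
  · intro hwe
    have h1 := ha _ hwe (by
      intro h2
      apply hz' w hw.1
      rw [← h2, G.flip_flip (w, ext w) hww])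
    rw [G.flip_flip (w, ext w) hww, hw.1] at h1
    simp at h1

end Tight

/-- In a bridgeless cubic multigraph with a labelling, there is a perfect matching through any
given edge that meets every odd class. -/
theorem Bridgeless.solvable [DecidableEq L] {G : CubicMultigraph V} (hG : G.Bridgeless)
    {lab : V → Option L} {ext : V → Fin 3} (hlab : G.IsLabelling lab ext) {e : V × Fin 3}
    (he : e.1 ∈ G.verts) : G.Solvable lab ext e := by
  induction hn : G.verts.card using Nat.strong_induction_on generalizing G lab ext e with
  | _ n ihn =>
    have ih : G.SolvableBelow L := fun G' hlt hG' lab' ext' hlab' e' he' =>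
      ihn _ (hn ▸ hlt) hG' hlab' he' rfl
    by_cases h4 : G.verts.card ≤ 4
    · exact hG.solvable_of_card_le_four h4 hlab he
    by_cases h3 : G.ThreeCutsTrivial
    · have hT : G.Tight := ⟨hG, h3, by omega⟩
      have hzW := G.flip_mem e he
      by_cases ha : ∀ p : V × Fin 3, p.1 = e.1 → p ≠ e → lab (G.flip p).1 = none
      · by_cases hz : ∀ p : V × Fin 3, p.1 = (G.flip e).1 → p ≠ G.flip e →
            lab (G.flip p).1 = none
        · exact hT.solvable_of_unlabelled ih hlab he ha (Tight.label_eq_none hlab hzW hz)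
        · push Not at hz
          obtain ⟨p, hp, hpe, hc⟩ := hz
          obtain ⟨c, hc⟩ := Option.ne_none_iff_exists'.1 hc
          exact (hT.solvable_of_labelled ih hlab hzW hp hpe hc).of_flip he
      · push Not at ha
        obtain ⟨p, hp, hpe, hc⟩ := ha
        obtain ⟨c, hc⟩ := Option.ne_none_iff_exists'.1 hc
        exact hT.solvable_of_labelled ih hlab he hp hpe hc
    · exact hG.solvable_of_not_threeCutsTrivial ih hlab h3 he

end

/-! ### From simple graphs to multigraphs -/

section

variable {V : Type*}

theorem exists_ext (P : Fin 3 → Prop) [DecidablePred P]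
    (h : (univ.filter P).card = 2) : ∃ j, ∀ i, i ≠ j ↔ P i := by
  have h1 : (univ.filter fun i => ¬ P i).card = 1 := by
    have := Finset.card_filter_add_card_filter_not (s := (univ : Finset (Fin 3))) P
    simp only [Finset.card_univ, Fintype.card_fin] at this
    omega
  obtain ⟨j, hj⟩ := Finset.card_eq_one.1 h1
  refine ⟨j, fun i => ?_⟩
  have := Finset.ext_iff.1 hj i
  simp only [mem_filter, mem_univ, true_and, mem_singleton] at this
  tauto

/-- A cubic simple graph, with its neighbourhoods enumerated, as a multigraph. -/
def ofSimpleGraph [Fintype V] (G : SimpleGraph V) (nbr : ∀ v, Fin 3 ≃ G.neighborSet v) :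
    CubicMultigraph V where
  verts := univ
  flip d := (nbr d.1 d.2, (nbr (nbr d.1 d.2)).symm ⟨d.1, (nbr d.1 d.2).2.symm⟩)
  flip_flip := by
    rintro ⟨v, i⟩ -
    ext1
    · simp
    · have symm_eq : ∀ {w u} (hu : G.Adj w u), w = v → u = nbr v i →
          (nbr w).symm ⟨u, hu⟩ = i := by
        rintro w u hu rfl rfl
        exact (nbr w).symm_apply_apply i
      exact symm_eq _ (by simp) rfl
  flip_mem := by simp
  flip_ne := fun d _ h => (nbr d.1 d.2).2.ne (congrArg Prod.fst h).symm

section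

variable [Fintype V] {G : SimpleGraph V} {nbr : ∀ v, Fin 3 ≃ G.neighborSet v}

theorem flip_ofSimpleGraph_eq_iff {d : V × Fin 3} {v : V} {i : Fin 3} :
    (ofSimpleGraph G nbr).flip d = (v, i) ↔ (nbr d.1 d.2 : V) = v ∧ (nbr v i : V) = d.1 := by
  constructor
  · intro h
    have h1 : (nbr d.1 d.2 : V) = v := congrArg Prod.fst h
    refine ⟨h1, ?_⟩
    have h2 := congrArg Prod.fst ((ofSimpleGraph G nbr).flip_flip d (mem_univ _))
    rw [h] at h2
    exact h2
  · rintro ⟨h1, h2⟩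
    subst h1
    refine Prod.ext rfl ?_
    change (nbr _).symm _ = i
    rw [Equiv.symm_apply_eq]
    ext
    exact h2.symm

theorem nbr_flip (d : V × Fin 3) :
    (nbr ((ofSimpleGraph G nbr).flip d).1 ((ofSimpleGraph G nbr).flip d).2 : V) = d.1 :=
  (flip_ofSimpleGraph_eq_iff.1 (Prod.mk.eta (p := (ofSimpleGraph G nbr).flip d)).symm).2

theorem bridgeless_ofSimpleGraph [DecidableEq V] (h : ∀ e : Sym2 V, ¬ G.IsBridge e) :
    (ofSimpleGraph G nbr).Bridgeless := by
  intro X _ hX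
  obtain ⟨d, hd⟩ := Finset.card_eq_one.1 hX
  have hdX := mem_cut.1 (hd ▸ mem_singleton_self d)
  have hb := h s(d.1, (nbr d.1 d.2 : V))
  rw [SimpleGraph.isBridge_iff, not_not] at hb
  obtain ⟨p⟩ := hb
  obtain ⟨⟨⟨a, b⟩, hab⟩, -, ha, hb⟩ := p.exists_boundary_dart (X : Set V) hdX.1 hdX.2
  rw [SimpleGraph.deleteEdges_adj] at hab
  obtain ⟨i, hi⟩ := (nbr a).surjective ⟨b, hab.1⟩
  have hi' : (nbr a i : V) = b := by rw [hi]
  have hmem : (a, i) ∈ (ofSimpleGraph G nbr).cut X := by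
    refine mem_cut.2 ⟨ha, ?_⟩
    change (nbr a i : V) ∉ X
    rwa [hi']
  rw [hd, mem_singleton] at hmem
  subst hmem
  exact hab.2 (by rw [hi']; rfl)

theorem exists_perfectMatching {m : V → Fin 3} (hm : (ofSimpleGraph G nbr).IsMatching m) :
    ∃ M : G.Subgraph, M.IsPerfectMatching ∧ ∀ v, M.Adj v (nbr v (m v)) := by
  refine ⟨⟨Set.univ, fun v w => (nbr v (m v) : V) = w, ?_, fun _ => Set.mem_univ _, ?_⟩, ?_,
    fun _ => rfl⟩
  · rintro v w rfl
    exact (nbr v (m v)).2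
  · refine ⟨fun v w hvw => ?_⟩
    subst hvw
    have h1 := hm (v, m v) (mem_univ _) rfl
    have h2 := nbr_flip (G := G) (nbr := nbr) (v, m v)
    rw [← h1] at h2
    exact h2
  · rw [SimpleGraph.Subgraph.isPerfectMatching_iff]
    exact fun v => ⟨_, rfl, fun w hw => Eq.symm hw⟩

theorem card_verts_eq_card_edgeSet {C : G.Subgraph}
    (hC : ∀ v ∈ C.verts, (C.neighborSet v).ncard = 2) : C.verts.ncard = C.edgeSet.ncard := by
  classical
  have h := C.spanningCoe.sum_degrees_eq_twice_card_edges
  have h1 : ∀ v, C.spanningCoe.degree v = if v ∈ C.verts then 2 else 0 := by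
    intro v
    have h2 : C.spanningCoe.degree v = (C.neighborSet v).ncard := by
      rw [← SimpleGraph.card_neighborSet_eq_degree, ← Nat.card_eq_fintype_card]
      rfl
    rw [h2]
    split_ifs with hv
    · exact hC v hv
    · rw [Set.ncard_eq_zero]
      exact Set.eq_empty_of_forall_notMem fun w hw => hv (C.edge_vert hw)
  rw [Finset.sum_congr rfl fun v _ => h1 v, ← Finset.sum_filter, Finset.sum_const,
    smul_eq_mul] at h
  have h3 : C.spanningCoe.edgeFinset.card = C.edgeSet.ncard := by
    rw [← Set.ncard_coe_finset, SimpleGraph.coe_edgeFinset]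
    rfl
  have h4 : (univ.filter fun v => v ∈ C.verts).card = C.verts.ncard := by
    rw [← Set.ncard_coe_finset]
    simp
  omega

omit [Fintype V] in
theorem exists_ext_subgraph {C : G.Subgraph} {v : V} (hv : (C.neighborSet v).ncard = 2) :
    ∃ j, ∀ i, i ≠ j ↔ C.Adj v (nbr v i) := by
  classical
  apply exists_ext
  rw [← hv, ← Set.ncard_coe_finset]
  refine Set.ncard_congr (fun i _ => (nbr v i : V)) (fun i hi => by simpa using hi) ?_ ?_
  · intro i j _ _ hij
    exact (nbr v).injective (Subtype.ext hij)
  · intro w hw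
    obtain ⟨i, hi⟩ := (nbr v).surjective ⟨w, C.adj_sub hw⟩
    refine ⟨i, ?_, by rw [hi]⟩
    have hw' : C.Adj v w := hw
    simpa [hi] using hw'

end

end

end CubicMultigraph

/-- For every bridgeless cubic graph `G` and every collection `𝒪` of pairwise
vertex-disjoint odd circuits (connected 2-regular subgraphs with an odd number of edges)
of `G`, there is a perfect matching of `G` meeting every circuit of `𝒪`. -/
theorem perfect_matching_hits_disjoint_odd_circuits {V : Type*} [Fintype V]
    (G : SimpleGraph V)
    (hcubic : ∀ v : V, (G.neighborSet v).ncard = 3)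
    (hbridgeless : ∀ e : Sym2 V, ¬ G.IsBridge e)
    (𝒪 : Set G.Subgraph)
    (hcirc : ∀ C ∈ 𝒪, C.Connected ∧ (∀ v ∈ C.verts, (C.neighborSet v).ncard = 2) ∧
      Odd C.edgeSet.ncard)
    (hdisj : ∀ C ∈ 𝒪, ∀ D ∈ 𝒪, C ≠ D → Disjoint C.verts D.verts) :
    ∃ M : G.Subgraph, M.IsPerfectMatching ∧
      ∀ C ∈ 𝒪, (M.edgeSet ∩ C.edgeSet).Nonempty := by
  classical
  have hnbr : ∀ v, Nonempty (Fin 3 ≃ G.neighborSet v) := fun v =>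
    ⟨(Finite.equivFinOfCardEq (hcubic v)).symm⟩
  let nbr : ∀ v, Fin 3 ≃ G.neighborSet v := fun v => (hnbr v).some
  let lab : V → Option G.Subgraph := fun v =>
    if h : ∃ C ∈ 𝒪, v ∈ C.verts then some h.choose else none
  have hlab : ∀ v C, lab v = some C ↔ C ∈ 𝒪 ∧ v ∈ C.verts := by
    intro v C
    constructor
    · intro h
      by_cases hv : ∃ C ∈ 𝒪, v ∈ C.verts
      · rw [show lab v = some hv.choose from dif_pos hv, Option.some_inj] at h
        exact h ▸ hv.choose_spec
      · rw [show lab v = none from dif_neg hv] at h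
        cases h
    · rintro ⟨hC, hvC⟩
      have hv : ∃ C ∈ 𝒪, v ∈ C.verts := ⟨C, hC, hvC⟩
      rw [show lab v = some hv.choose from dif_pos hv, Option.some_inj]
      by_contra hne
      exact Set.disjoint_left.1 (hdisj _ hv.choose_spec.1 _ hC hne) hv.choose_spec.2 hvC
  have hext : ∀ v, ∃ j, ∀ C, lab v = some C → ∀ i, i ≠ j ↔ C.Adj v (nbr v i) := by
    intro v
    rcases h : lab v with _ | C
    · exact ⟨0, by simp⟩
    · obtain ⟨hC, hv⟩ := (hlab v C).1 h
      obtain ⟨j, hj⟩ := CubicMultigraph.exists_ext_subgraph (nbr := nbr) ((hcirc C hC).2.1 v hv)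
      exact ⟨j, fun D hD => by cases hD; exact hj⟩
  choose ext hext using hext
  have hL : (CubicMultigraph.ofSimpleGraph G nbr).IsLabelling lab ext := by
    intro d _ C hC hd
    have hadj := (hext d.1 C hC d.2).1 hd
    have hC' := ((hlab _ _).2 ⟨((hlab _ _).1 hC).1, C.edge_vert hadj.symm⟩)
    refine ⟨hC', (hext _ C hC' _).2 ?_⟩
    have := CubicMultigraph.nbr_flip (G := G) (nbr := nbr) d
    exact this.symm ▸ hadj.symm
  rcases isEmpty_or_nonempty V with hV | ⟨⟨v₀⟩⟩
  · refine ⟨⊤, ?_, fun C hC => ?_⟩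
    · rw [SimpleGraph.Subgraph.isPerfectMatching_iff]
      exact fun v => isEmptyElim v
    · exact isEmptyElim (hcirc C hC).1.nonempty.some
  obtain ⟨m, hm, -, hhit⟩ := (CubicMultigraph.bridgeless_ofSimpleGraph hbridgeless).solvable hL
    (e := (v₀, 0)) (Finset.mem_univ _)
  obtain ⟨M, hM, hMm⟩ := CubicMultigraph.exists_perfectMatching hm
  refine ⟨M, hM, fun C hC => ?_⟩
  have hodd : Odd (((CubicMultigraph.ofSimpleGraph G nbr).verts.filter
      fun v => lab v = some C).card) := by
    obtain ⟨-, h2, h3⟩ := hcirc C hC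
    rw [← CubicMultigraph.card_verts_eq_card_edgeSet h2] at h3
    convert h3
    rw [← Set.ncard_coe_finset]
    congr 1
    ext v
    simp [hlab, hC, CubicMultigraph.ofSimpleGraph]
  obtain ⟨v, -, hv, hne⟩ := hhit C hodd
  exact ⟨s(v, (nbr v (m v) : V)), hMm v, (hext v C hv _).1 hne⟩
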